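/- Consider the $L_\infty$ approximation problem ${\rm APP} = \{{\rm APP}_{\infty,d}\}_{d \in \mathbb{N}}$ over the weighted Korobov spaces $H(K_{d,\mathbf{r},\mathbf{g}})$ in the worst case setting, for either information class $\Lambda \in \{\Lambda^{\rm std}, \Lambda^{\rm all}\}$ and either error criterion $\star \in \{{\rm ABS}, {\rm NOR}\}$. Then for $s > 0$ and $0 < t < 1$, ${\rm APP}$ is algebraically $(s,t)$-weakly tractable if and only if $\lim_{j \to \infty} j^{1-t} g_j \ln_+ \frac{1}{g_j} = 0$, where $\ln_+ x := \max(1, \ln x)$. -/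

import Mathlib

open Filter
open scoped ENNReal NNReal

noncomputable section

/-- Coefficient space: `ℓ²` sequences indexed by `ℤ^d`.  An element `u` represents the
function `f ∈ H^ω(𝕋^d)` with Fourier coefficients `f̂(k) = u k / ω k`, so that
`‖u‖_{ℓ²} = ‖f‖_{H^ω}`. -/
abbrev Coef (d : ℕ) := lp (fun _ : Fin d → ℤ => ℂ) 2

/-- The periodic function represented by the coefficients `u`:
`f(x) = ∑_{k ∈ ℤ^d} (u k / ω k) e^{2πi k·x}`. -/
def torusFn {d : ℕ} (ω : (Fin d → ℤ) → ℝ) (u : Coef d) (x : Fin d → ℝ) : ℂ :=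
  ∑' k : Fin d → ℤ,
    ((ω k : ℂ))⁻¹ * u k * Complex.exp (2 * Real.pi * Complex.I * ∑ j, (k j : ℂ) * (x j : ℂ))

/-- The torus `𝕋^d`, modelled as the cube `[0,1]^d`. -/
def cube (d : ℕ) : Set (Fin d → ℝ) := {x | ∀ j, x j ∈ Set.Icc (0 : ℝ) 1}

/-- Standard information: point-evaluation functionals `f ↦ f(x)`. -/
def stdInfo {d : ℕ} (ω : (Fin d → ℤ) → ℝ) : Set (Coef d → ℂ) :=
  {L | ∃ x ∈ cube d, L = fun u => torusFn ω u x}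

/-- General linear information: all continuous linear functionals on `H^ω`. -/
def allInfo (d : ℕ) : Set (Coef d → ℂ) := {L | ∃ T : Coef d →L[ℂ] ℂ, L = ⇑T}

/-- The `n`-th minimal worst case error `e(n, APP_{∞,d}; Λ)` of `L_∞`-approximation on the
unit ball of `H^ω(𝕋^d)`, using algorithms `f ↦ φ(L₁ f, …, Lₙ f)` with `Lᵢ ∈ Λ`. -/
def wcErr {d : ℕ} (ω : (Fin d → ℤ) → ℝ) (Λ : Set (Coef d → ℂ)) (n : ℕ) : ℝ≥0∞ :=
  ⨅ (L : Fin n → Coef d → ℂ) (_ : ∀ i, L i ∈ Λ) (φ : (Fin n → ℂ) → (Fin d → ℝ) → ℂ),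
    ⨆ (u : Coef d) (_ : ‖u‖ ≤ 1) (x : Fin d → ℝ) (_ : x ∈ cube d),
      (‖torusFn ω u x - φ (fun i => L i u) x‖₊ : ℝ≥0∞)

/-- The initial error `e(0, APP_{∞,d}) = sup_{‖f‖_{H^ω} ≤ 1} ‖f‖_∞`. -/
def initErr {d : ℕ} (ω : (Fin d → ℤ) → ℝ) : ℝ≥0∞ :=
  ⨆ (u : Coef d) (_ : ‖u‖ ≤ 1) (x : Fin d → ℝ) (_ : x ∈ cube d),
    (‖torusFn ω u x‖₊ : ℝ≥0∞)

/-- The error criterion: absolute (ABS) or normalized (NOR). -/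
inductive Crit | ABS | NOR

/-- `CRI_d`: the normalizing quantity of the error criterion. -/
def CRI {d : ℕ} (ω : (Fin d → ℤ) → ℝ) : Crit → ℝ≥0∞
  | Crit.ABS => 1
  | Crit.NOR => initErr ω

/-- The information complexity `n^⋆(ε, d; Λ)`. -/
def infoComp {d : ℕ} (ω : (Fin d → ℤ) → ℝ) (Λ : Set (Coef d → ℂ)) (crit : Crit) (ε : ℝ) : ℕ :=
  sInf {n : ℕ | wcErr ω Λ n ≤ ENNReal.ofReal ε * CRI ω crit}

/-- Algebraic strong polynomial tractability of the family of information complexities `nc`. -/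
def ALGSPT (nc : ℕ → ℝ → ℕ) : Prop :=
  ∃ C > (0:ℝ), ∃ p ≥ (0:ℝ), ∀ d : ℕ, 0 < d → ∀ ε ∈ Set.Ioo (0:ℝ) 1,
    (nc d ε : ℝ) ≤ C * ε ^ (-p)

/-- The exponent of algebraic strong polynomial tractability. -/
def ALGSPTexp (nc : ℕ → ℝ → ℕ) : ℝ :=
  sInf {p : ℝ | 0 ≤ p ∧ ∃ C > (0:ℝ), ∀ d : ℕ, 0 < d → ∀ ε ∈ Set.Ioo (0:ℝ) 1,
    (nc d ε : ℝ) ≤ C * ε ^ (-p)}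

/-- Algebraic polynomial tractability. -/
def ALGPT (nc : ℕ → ℝ → ℕ) : Prop :=
  ∃ C > (0:ℝ), ∃ p ≥ (0:ℝ), ∃ q ≥ (0:ℝ), ∀ d : ℕ, 0 < d → ∀ ε ∈ Set.Ioo (0:ℝ) 1,
    (nc d ε : ℝ) ≤ C * (d : ℝ) ^ q * ε ^ (-p)

/-- Algebraic quasi-polynomial tractability. -/
def ALGQPT (nc : ℕ → ℝ → ℕ) : Prop :=
  ∃ C > (0:ℝ), ∃ t ≥ (0:ℝ), ∀ d : ℕ, 0 < d → ∀ ε ∈ Set.Ioo (0:ℝ) 1,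
    (nc d ε : ℝ) ≤ C * Real.exp (t * (1 + Real.log d) * (1 + Real.log ε⁻¹))

/-- The exponent of algebraic quasi-polynomial tractability. -/
def ALGQPTexp (nc : ℕ → ℝ → ℕ) : ℝ :=
  sInf {t : ℝ | 0 ≤ t ∧ ∃ C > (0:ℝ), ∀ d : ℕ, 0 < d → ∀ ε ∈ Set.Ioo (0:ℝ) 1,
    (nc d ε : ℝ) ≤ C * Real.exp (t * (1 + Real.log d) * (1 + Real.log ε⁻¹))}

/-- Exponential quasi-polynomial tractability. -/
def EXPQPT (nc : ℕ → ℝ → ℕ) : Prop :=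
  ∃ C > (0:ℝ), ∃ t ≥ (0:ℝ), ∀ d : ℕ, 0 < d → ∀ ε ∈ Set.Ioo (0:ℝ) 1,
    (nc d ε : ℝ) ≤ C * Real.exp (t * (1 + Real.log d) * (1 + Real.log (Real.log ε⁻¹ + 1)))

/-- The exponent of exponential quasi-polynomial tractability. -/
def EXPQPTexp (nc : ℕ → ℝ → ℕ) : ℝ :=
  sInf {t : ℝ | 0 ≤ t ∧ ∃ C > (0:ℝ), ∀ d : ℕ, 0 < d → ∀ ε ∈ Set.Ioo (0:ℝ) 1,
    (nc d ε : ℝ) ≤ C * Real.exp (t * (1 + Real.log d) * (1 + Real.log (Real.log ε⁻¹ + 1)))}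

/-- `lim_{ε⁻¹ + d → ∞} (log nc(d, ε)) / den(d, ε) = 0`. -/
def WTlim (den : ℕ → ℝ → ℝ) (nc : ℕ → ℝ → ℕ) : Prop :=
  ∀ δ > (0:ℝ), ∃ M : ℝ, ∀ d : ℕ, 0 < d → ∀ ε ∈ Set.Ioo (0:ℝ) 1,
    M ≤ ε⁻¹ + d → |Real.log (nc d ε) / den d ε| < δ

/-- Algebraic `(s,t)`-weak tractability; `ALGWTst 1 1` is algebraic weak tractability. -/
def ALGWTst (s t : ℝ) (nc : ℕ → ℝ → ℕ) : Prop :=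
  WTlim (fun d ε => ε ^ (-s) + (d : ℝ) ^ t) nc

/-- Algebraic uniform weak tractability. -/
def ALGUWT (nc : ℕ → ℝ → ℕ) : Prop := ∀ α > (0:ℝ), ∀ β > (0:ℝ), ALGWTst α β nc

/-- Exponential `(s,t)`-weak tractability; `EXPWTst 1 1` is exponential weak tractability. -/
def EXPWTst (s t : ℝ) (nc : ℕ → ℝ → ℕ) : Prop :=
  WTlim (fun d ε => (1 + Real.log ε⁻¹) ^ s + (d : ℝ) ^ t) nc

/-- Exponential uniform weak tractability. -/
def EXPUWT (nc : ℕ → ℝ → ℕ) : Prop := ∀ α > (0:ℝ), ∀ β > (0:ℝ), EXPWTst α β nc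

/-- `ln₊ x = max(1, ln x)`. -/
def lnplus (x : ℝ) : ℝ := max 1 (Real.log x)

/-- The weight `ω` of the weighted Korobov space `H(K_{d,r,g})`, i.e.
`ω(h) = √(ρ_{d,r,g}(h))` with `ρ_{d,r,g}(h) = ∏_j τ_j(h_j)`, `τ_j(0) = 1` and
`τ_j(h) = g_j⁻¹ |h|^{2 r_j}` for `h ≠ 0` (coordinate `j` uses `g_{j+1}, r_{j+1}`,
the sequences being indexed starting from `1`). -/
def korWeight (g r : ℕ → ℝ) (d : ℕ) (h : Fin d → ℤ) : ℝ :=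
  Real.sqrt (∏ j : Fin d,
    if h j = 0 then 1 else (g (j.1 + 1))⁻¹ * (|h j| : ℝ) ^ (2 * r (j.1 + 1)))

/-- The information complexity function of `L_∞`-approximation over the weighted Korobov
spaces, for the class `Λ^std` (`useStd = true`) or `Λ^all` (`useStd = false`). -/
def korNC (g r : ℕ → ℝ) (useStd : Bool) (crit : Crit) : ℕ → ℝ → ℕ := fun d ε =>
  infoComp (korWeight g r d) (if useStd then stdInfo (korWeight g r d) else allInfo d) crit ε


def ek {d : ℕ} (k : Fin d → ℤ) (x : Fin d → ℝ) : ℂ :=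
  Complex.exp (2 * Real.pi * Complex.I * ∑ j, (k j : ℂ) * (x j : ℂ))

lemma ek_norm {d : ℕ} (k : Fin d → ℤ) (x : Fin d → ℝ) : ‖ek k x‖ = 1 := by
  have : (2 * Real.pi * Complex.I * ∑ j, (k j : ℂ) * (x j : ℂ))
      = ((2 * Real.pi * ∑ j, (k j : ℝ) * x j : ℝ) : ℂ) * Complex.I := by
    push_cast; ring
  rw [ek, this, Complex.norm_exp_ofReal_mul_I]

lemma card_ker_le {p d : ℕ} [Fact p.Prime] (h : Fin d → ZMod p) (hh : h ≠ 0) :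
    (Finset.univ.filter (fun z : Fin d → ZMod p => ∑ j, h j * z j = 0)).card * p ≤ p ^ d := by
  classical
  obtain ⟨j0, hj0⟩ := Function.ne_iff.mp hh
  simp only [Pi.zero_apply] at hj0
  have key : Function.Injective (fun q : {z : Fin d → ZMod p // ∑ j, h j * z j = 0} × ZMod p =>
      (fun j => q.1.1 j + (if j = j0 then q.2 else 0) : Fin d → ZMod p)) := by
    rintro ⟨⟨z, hz⟩, a⟩ ⟨⟨w, hw⟩, b⟩ hq
    have hq' : ∀ j, z j + (if j = j0 then a else 0) = w j + (if j = j0 then b else 0) :=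
      fun j => congrFun hq j
    have e : ∑ j, h j * (z j + (if j = j0 then a else 0))
        = ∑ j, h j * (w j + (if j = j0 then b else 0)) :=
      Finset.sum_congr rfl (fun j _ => by rw [hq' j])
    simp only [mul_add, Finset.sum_add_distrib, hz, hw, mul_ite, mul_zero,
      Finset.sum_ite_eq', Finset.mem_univ, if_true, zero_add] at e
    have hab : a = b := mul_left_cancel₀ hj0 e
    subst hab
    have : z = w := by
      funext j; exact add_right_cancel (hq' j)
    subst this; rfl
  have := Fintype.card_le_of_injective _ key
  rw [Fintype.card_prod, Fintype.card_subtype, ZMod.card, Fintype.card_fun, ZMod.card,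
    Fintype.card_fin] at this
  exact this

lemma exists_z {p d : ℕ} [Fact p.Prime] (H : Finset (Fin d → ZMod p)) (hH : H.card < p)
    (h0 : ∀ h ∈ H, h ≠ 0) : ∃ z : Fin d → ZMod p, ∀ h ∈ H, ∑ j, h j * z j ≠ 0 := by
  classical
  by_contra hcon
  push Not at hcon
  have hsub : (Finset.univ : Finset (Fin d → ZMod p)) ⊆
      H.biUnion (fun h => Finset.univ.filter (fun z : Fin d → ZMod p => ∑ j, h j * z j = 0)) := by
    intro z _
    obtain ⟨h, hh, hz⟩ := hcon z
    exact Finset.mem_biUnion.mpr ⟨h, hh, by simp [hz]⟩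
  have h1 := (Finset.card_le_card hsub).trans Finset.card_biUnion_le
  rw [Finset.card_univ, Fintype.card_fun, ZMod.card, Fintype.card_fin] at h1
  have h2 : (∑ h ∈ H, (Finset.univ.filter
      (fun z : Fin d → ZMod p => ∑ j, h j * z j = 0)).card) * p ≤ H.card * p ^ d := by
    rw [Finset.sum_mul]
    calc _ ≤ ∑ h ∈ H, p ^ d := Finset.sum_le_sum (fun h hh => card_ker_le h (h0 h hh))
      _ = _ := by simp
  have hp : 0 < p ^ d := pow_pos (Fact.out : p.Prime).pos d
  have h3 : p ^ d * p ≤ H.card * p ^ d := (Nat.mul_le_mul_right p h1).trans h2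
  nlinarith

lemma lattice {d : ℕ} (K : Finset (Fin d → ℤ)) (p : ℕ) (hp : p.Prime)
    (h1 : K.card ^ 2 < p) (h2 : ∀ k ∈ K, ∀ j, 2 * |k j| < p) :
    ∃ (x : Fin p → Fin d → ℝ) (c : (Fin d → ℤ) → ZMod p), (∀ i, x i ∈ cube d) ∧
      Set.InjOn c K ∧ ∀ l k, ∑ i, ek l (x i) * (starRingEnd ℂ) (ek k (x i))
        = if c l = c k then (p : ℂ) else 0 := by
  classical
  have : Fact p.Prime := ⟨hp⟩
  obtain ⟨z, hz⟩ := exists_z (p := p) (d := d)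
    (K.offDiag.image (fun q => fun j => ((q.1 j - q.2 j : ℤ) : ZMod p)))
    (by
      refine lt_of_le_of_lt Finset.card_image_le (lt_of_le_of_lt ?_ h1)
      rw [Finset.offDiag_card, sq]; omega)
    (by
      intro h hh
      obtain ⟨q, hq, rfl⟩ := Finset.mem_image.mp hh
      obtain ⟨hq1, hq2, hne⟩ := Finset.mem_offDiag.mp hq
      intro h0
      apply hne
      funext j
      have := congrFun h0 j
      simp only [Pi.zero_apply] at this
      rw [ZMod.intCast_zmod_eq_zero_iff_dvd] at this
      have b1 := h2 _ hq1 j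
      have b2 := h2 _ hq2 j
      have : q.1 j - q.2 j = 0 := by
        apply Int.eq_zero_of_abs_lt_dvd this
        have := abs_sub (q.1 j) (q.2 j)
        linarith
      linarith)
  let e : Fin p ≃ ZMod p := (Fintype.equivFinOfCardEq (ZMod.card p)).symm
  let c : (Fin d → ℤ) → ZMod p := fun k => ∑ j, (k j : ZMod p) * z j
  have hpos : (0 : ℝ) < p := by exact_mod_cast hp.pos
  have hek : ∀ (k : Fin d → ℤ) (i : ZMod p),
      ek k (fun j => ((i * z j).val : ℝ) / p) = ZMod.stdAddChar (i * c k) := by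
    intro k i
    have h : i * c k = ((∑ j, k j * ((i * z j).val : ℤ) : ℤ) : ZMod p) := by
      push_cast
      simp only [ZMod.natCast_val, ZMod.cast_id', id, c, Finset.mul_sum]
      exact Finset.sum_congr rfl (fun j _ => by ring)
    rw [h, ZMod.stdAddChar_coe, ek]
    congr 1
    push_cast
    rw [mul_div_assoc, Finset.sum_div]
    congr 1
    exact Finset.sum_congr rfl (fun j _ => by ring)
  refine ⟨fun i j => ((e i * z j).val : ℝ) / p, c, ?_, ?_, ?_⟩
  · intro i j
    refine ⟨by positivity, ?_⟩
    rw [div_le_one hpos]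
    exact_mod_cast (ZMod.val_lt _).le
  · intro k hk k' hk' hc
    by_contra hne
    have hm : (k, k') ∈ K.offDiag := Finset.mem_offDiag.mpr ⟨hk, hk', hne⟩
    apply hz _ (Finset.mem_image_of_mem _ hm)
    simp only [Int.cast_sub, sub_mul, Finset.sum_sub_distrib]
    exact sub_eq_zero.mpr hc
  · intro l k
    have : ∀ i : Fin p, ek l (fun j => ((e i * z j).val : ℝ) / p) *
        (starRingEnd ℂ) (ek k (fun j => ((e i * z j).val : ℝ) / p))
        = ZMod.stdAddChar (e i * (c l - c k)) := by
      intro i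
      rw [hek, hek, ← AddChar.map_neg_eq_conj, ← AddChar.map_add_eq_mul]
      congr 1; ring
    simp only [this]
    rw [Equiv.sum_comp e (fun i => ZMod.stdAddChar (i * (c l - c k))),
      AddChar.sum_mulShift _ (ZMod.isPrimitive_stdAddChar p)]
    simp only [sub_eq_zero, ZMod.card]
    split_ifs <;> simp

lemma cs {d : ℕ} (b : (Fin d → ℤ) → ℂ) (hb : Summable (fun k => ‖b k‖ ^ 2)) (u : Coef d) :
    Summable (fun k => b k * u k) ∧
      ‖∑' k, b k * u k‖ ≤ Real.sqrt (∑' k, ‖b k‖ ^ 2) * ‖u‖ := by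
  have h2 : (0 : ℝ) < (2 : ℝ≥0∞).toReal := by simp
  have hu := lp.hasSum_norm h2 u
  simp only [ENNReal.toReal_ofNat, Real.rpow_ofNat] at hu
  have hs : Summable (fun k => ‖b k * u k‖) := by
    refine Summable.of_nonneg_of_le (fun _ => norm_nonneg _) (fun k => ?_) (hb.add hu.summable)
    rw [norm_mul]
    nlinarith [sq_nonneg (‖b k‖ - ‖u k‖), norm_nonneg (b k), norm_nonneg (u k)]
  refine ⟨hs.of_norm, (norm_tsum_le_tsum_norm hs).trans ?_⟩
  have := Real.inner_le_Lp_mul_Lq_tsum_of_nonneg (f := fun k => ‖b k‖) (g := fun k => ‖u k‖)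
    (p := 2) (q := 2) Real.HolderConjugate.two_two (fun _ => norm_nonneg _)
    (fun _ => norm_nonneg _) (by simpa using hb) (by simpa using hu.summable)
  simp only [Real.rpow_ofNat, ← Real.sqrt_eq_rpow, hu.tsum_eq, Real.sqrt_sq (norm_nonneg u)] at this
  simpa only [norm_mul] using this


lemma nn_coe (z : ℂ) : ((‖z‖₊ : ℝ≥0) : ℝ≥0∞) = ENNReal.ofReal ‖z‖ := by
  rw [← coe_nnnorm, ENNReal.ofReal_coe_nnreal]

lemma HasSum.congr_fun' {α : Type*} {f g : α → ℂ} {a : ℂ} (h : HasSum f a)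
    (hfg : ∀ l, g l = f l) : HasSum g a := by
  have : g = f := funext hfg
  rw [this]; exact h

lemma torusFn_eq {d : ℕ} (ω : (Fin d → ℤ) → ℝ) (u : Coef d) (x : Fin d → ℝ) :
    torusFn ω u x = ∑' k, ((ω k : ℂ)⁻¹ * ek k x) * u k := by
  unfold torusFn ek
  exact tsum_congr (fun k => by ring)

lemma coef_norm {d : ℕ} (ω : (Fin d → ℤ) → ℝ) (k : Fin d → ℤ) (x : Fin d → ℝ) :
    ‖(ω k : ℂ)⁻¹ * ek k x‖ ^ 2 = ((ω k) ^ 2)⁻¹ := by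
  rw [norm_mul, ek_norm, mul_one, norm_inv, Complex.norm_real, inv_pow, Real.norm_eq_abs, sq_abs]

lemma torusFn_summable {d : ℕ} (ω : (Fin d → ℤ) → ℝ) (hω : Summable (fun k => ((ω k) ^ 2)⁻¹))
    (u : Coef d) (x : Fin d → ℝ) : Summable (fun k => ((ω k : ℂ)⁻¹ * ek k x) * u k) :=
  (cs _ (by simpa only [coef_norm] using hω) u).1

lemma torusFn_le {d : ℕ} (ω : (Fin d → ℤ) → ℝ) (hω : Summable (fun k => ((ω k) ^ 2)⁻¹))
    (u : Coef d) (x : Fin d → ℝ) :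
    ‖torusFn ω u x‖ ≤ Real.sqrt (∑' k, ((ω k) ^ 2)⁻¹) * ‖u‖ := by
  rw [torusFn_eq]
  have := (cs (fun k => (ω k : ℂ)⁻¹ * ek k x) (by simpa only [coef_norm] using hω) u).2
  simpa only [coef_norm] using this

lemma std_sub_all {d : ℕ} (ω : (Fin d → ℤ) → ℝ) (hω : Summable (fun k => ((ω k) ^ 2)⁻¹)) :
    stdInfo ω ⊆ allInfo d := by
  rintro L ⟨x, -, rfl⟩
  let f : Coef d →ₗ[ℂ] ℂ :=
    { toFun := fun u => torusFn ω u x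
      map_add' := by
        intro u v
        rw [torusFn_eq, torusFn_eq, torusFn_eq,
          ← (torusFn_summable ω hω u x).tsum_add (torusFn_summable ω hω v x)]
        refine tsum_congr (fun k => ?_)
        rw [lp.coeFn_add, Pi.add_apply]; ring
      map_smul' := by
        intro a u
        rw [torusFn_eq, torusFn_eq, RingHom.id_apply, smul_eq_mul, ← tsum_mul_left]
        refine tsum_congr (fun k => ?_)
        rw [lp.coeFn_smul, Pi.smul_apply, smul_eq_mul]; ring }
  exact ⟨f.mkContinuous _ (fun u => torusFn_le ω hω u x), rfl⟩

lemma wcErr_anti {d : ℕ} (ω : (Fin d → ℤ) → ℝ) {Λ Λ' : Set (Coef d → ℂ)} (h : Λ ⊆ Λ') (n : ℕ) :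
    wcErr ω Λ' n ≤ wcErr ω Λ n := by
  unfold wcErr
  refine le_iInf fun L => le_iInf fun hL => ?_
  exact (iInf_le _ L).trans (iInf_le _ (fun i => h (hL i)))

lemma initErr_le {d : ℕ} (ω : (Fin d → ℤ) → ℝ) (hω : Summable (fun k => ((ω k) ^ 2)⁻¹)) :
    initErr ω ≤ ENNReal.ofReal (Real.sqrt (∑' k, ((ω k) ^ 2)⁻¹)) := by
  unfold initErr
  refine iSup_le fun u => iSup_le fun hu => iSup_le fun x => iSup_le fun _ => ?_
  rw [nn_coe]
  refine ENNReal.ofReal_le_ofReal ((torusFn_le ω hω u x).trans ?_)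
  exact mul_le_of_le_one_right (Real.sqrt_nonneg _) hu

lemma one_le_initErr {d : ℕ} (ω : (Fin d → ℤ) → ℝ) (h0 : ω 0 = 1) : 1 ≤ initErr ω := by
  classical
  unfold initErr
  let u : Coef d := lp.single 2 (0 : Fin d → ℤ) (1 : ℂ)
  have hu : ‖u‖ ≤ 1 := by
    have : ‖u‖ = ‖(1 : ℂ)‖ := lp.norm_single (p := 2) (by simp) _ _
    rw [this]; simp
  have hx : (0 : Fin d → ℝ) ∈ cube d := fun j => by simp
  have hv : torusFn ω u 0 = 1 := by
    rw [torusFn_eq, tsum_eq_single 0]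
    · simp [u, h0, ek]
    · intro k hk
      simp [u, lp.single_apply, hk]
  refine le_trans ?_ (le_iSup_of_le u (le_iSup_of_le hu (le_iSup_of_le 0 (le_iSup_of_le hx le_rfl))))
  rw [hv]; simp

lemma std_upper {d : ℕ} (ω : (Fin d → ℤ) → ℝ) (hω : Summable (fun k => ((ω k) ^ 2)⁻¹))
    (K : Finset (Fin d → ℤ)) (p : ℕ) (hp : p.Prime)
    (h1 : K.card ^ 2 < p) (h2 : ∀ k ∈ K, ∀ j, 2 * |k j| < p) (ε : ℝ) (hε : 0 ≤ ε)
    (htail : ∀ F : Finset (Fin d → ℤ), (∀ k ∈ F, k ∉ K) → 4 * ∑ k ∈ F, ((ω k) ^ 2)⁻¹ ≤ ε ^ 2) :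
    wcErr ω (stdInfo ω) p ≤ ENNReal.ofReal ε := by
  classical
  obtain ⟨x, c, hx, hc, hort⟩ := lattice K p hp h1 h2
  have hp0 : (p : ℂ) ≠ 0 := by exact_mod_cast hp.ne_zero
  unfold wcErr
  let φ : (Fin p → ℂ) → (Fin d → ℝ) → ℂ := fun y t =>
    ∑ k ∈ K, ∑ i, (y i * ((starRingEnd ℂ) (ek k (x i)) * (p : ℂ)⁻¹ * ek k t))
  refine (iInf_le _ (fun i u => torusFn ω u (x i))).trans
    ((iInf_le _ (fun i => ⟨x i, hx i, rfl⟩)).trans ((iInf_le _ φ).trans ?_))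
  refine iSup_le fun u => iSup_le fun hu => iSup_le fun t => iSup_le fun _ => ?_
  rw [nn_coe]
  refine ENNReal.ofReal_le_ofReal ?_
  have hs : ∀ t, HasSum (fun l => ((ω l : ℂ)⁻¹ * ek l t) * u l) (torusFn ω u t) := by
    intro t
    rw [torusFn_eq]; exact (torusFn_summable ω hω u t).hasSum
  have hφ : HasSum (fun l => ∑ k ∈ K, ∑ i, (((ω l : ℂ)⁻¹ * ek l (x i)) * u l) *
      ((starRingEnd ℂ) (ek k (x i)) * (p : ℂ)⁻¹ * ek k t)) (φ (fun i => torusFn ω u (x i)) t) := by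
    refine hasSum_sum (fun k _ => hasSum_sum (fun i _ => ?_))
    exact (hs (x i)).mul_right _
  let β : (Fin d → ℤ) → ℂ := fun l => ek l t - ∑ k ∈ K, if c l = c k then ek k t else 0
  have hβ : HasSum (fun l => ((ω l : ℂ)⁻¹ * β l) * u l)
      (torusFn ω u t - φ (fun i => torusFn ω u (x i)) t) := by
    refine HasSum.congr_fun' ((hs t).sub hφ) (fun l => ?_)
    have : ∀ k, ∑ i, (((ω l : ℂ)⁻¹ * ek l (x i)) * u l) *
        ((starRingEnd ℂ) (ek k (x i)) * (p : ℂ)⁻¹ * ek k t)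
        = (ω l : ℂ)⁻¹ * u l * (if c l = c k then ek k t else 0) := by
      intro k
      have e : ∀ i, (((ω l : ℂ)⁻¹ * ek l (x i)) * u l) *
        ((starRingEnd ℂ) (ek k (x i)) * (p : ℂ)⁻¹ * ek k t) =
          (ω l : ℂ)⁻¹ * u l * (p : ℂ)⁻¹ * ek k t * (ek l (x i) * (starRingEnd ℂ) (ek k (x i))) := by
        intro i; ring
      simp only [e]
      rw [← Finset.mul_sum, hort]
      split_ifs
      · field_simp
      · simp
    simp only [this, β]
    rw [← Finset.mul_sum]; ring
  have hβK : ∀ l ∈ K, β l = 0 := by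
    intro l hl
    simp only [β]
    rw [Finset.sum_eq_single_of_mem l hl]
    · simp
    · intro k hk hkl
      rw [if_neg]
      intro h
      exact hkl (hc hk hl h.symm)
  have hβ2 : ∀ l, ‖β l‖ ≤ 2 := by
    intro l
    have hsum : ‖∑ k ∈ K, if c l = c k then ek k t else 0‖ ≤ 1 := by
      by_cases h : ∃ k ∈ K, c l = c k
      · obtain ⟨k, hk, hlk⟩ := h
        rw [Finset.sum_eq_single_of_mem k hk, if_pos hlk, ek_norm]
        intro k' hk' hne
        rw [if_neg]
        intro h
        exact hne (hc hk' hk (h.symm.trans hlk))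
      · push Not at h
        rw [Finset.sum_eq_zero]
        · simp
        · intro k hk; rw [if_neg (h k hk)]
    calc ‖β l‖ ≤ ‖ek l t‖ + _ := norm_sub_le _ _
      _ ≤ 1 + 1 := add_le_add (ek_norm _ _).le hsum
      _ = 2 := by norm_num
  have hb : ∀ l, ‖(ω l : ℂ)⁻¹ * β l‖ ^ 2 ≤ if l ∈ K then 0 else 4 * ((ω l) ^ 2)⁻¹ := by
    intro l
    split_ifs with h
    · simp [hβK l h]
    · rw [norm_mul, mul_pow, norm_inv, Complex.norm_real, inv_pow, Real.norm_eq_abs, sq_abs, mul_comm]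
      have : ‖β l‖ ^ 2 ≤ 4 := by nlinarith [hβ2 l, norm_nonneg (β l)]
      gcongr
  have hbs : ∀ F : Finset (Fin d → ℤ), ∑ l ∈ F, ‖(ω l : ℂ)⁻¹ * β l‖ ^ 2 ≤ ε ^ 2 := by
    intro F
    calc _ ≤ ∑ l ∈ F, if l ∈ K then 0 else 4 * ((ω l) ^ 2)⁻¹ := Finset.sum_le_sum (fun l _ => hb l)
      _ = 4 * ∑ l ∈ F.filter (fun l => l ∉ K), ((ω l) ^ 2)⁻¹ := by
        rw [Finset.mul_sum, Finset.sum_filter]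
        exact Finset.sum_congr rfl (fun l _ => by by_cases h : l ∈ K <;> simp [h])
      _ ≤ ε ^ 2 := htail _ (fun k hk => (Finset.mem_filter.mp hk).2)
  have hsm := summable_of_sum_le (fun l => sq_nonneg _) hbs
  have := (cs _ hsm u).2
  rw [hβ.tsum_eq] at this
  refine this.trans ((mul_le_of_le_one_right (Real.sqrt_nonneg _) hu).trans ?_)
  rw [Real.sqrt_le_left hε]
  exact Real.tsum_le_of_sum_le (fun l => sq_nonneg _) hbs


lemma parseval_fin {ι : Type*} [Fintype ι] [DecidableEq ι] {m : ℕ} (ψ : Fin m → ι → ℂ)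
    (hψ : ∀ l k, ∑ i, ψ i l * (starRingEnd ℂ) (ψ i k) = if l = k then (m : ℂ) else 0)
    (w : ι → ℂ) : ∑ i, ‖∑ k, w k * ψ i k‖ ^ 2 = m * ∑ k, ‖w k‖ ^ 2 := by
  have : ((∑ i, ‖∑ k, w k * ψ i k‖ ^ 2 : ℝ) : ℂ) = ((m * ∑ k, ‖w k‖ ^ 2 : ℝ) : ℂ) := by
    push_cast
    simp only [← Complex.mul_conj', map_sum, map_mul, Finset.sum_mul_sum]
    rw [Finset.sum_comm]
    rw [Finset.mul_sum]
    refine Finset.sum_congr rfl (fun l _ => ?_)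
    rw [Finset.sum_comm]
    have e : ∀ k, ∑ i, w l * ψ i l * ((starRingEnd ℂ) (w k) * (starRingEnd ℂ) (ψ i k))
        = w l * (starRingEnd ℂ) (w k) * (if l = k then (m : ℂ) else 0) := by
      intro k
      rw [← hψ, Finset.mul_sum]
      exact Finset.sum_congr rfl (fun i _ => by ring)
    simp only [e, mul_ite, mul_zero, Finset.sum_ite_eq, Finset.mem_univ, if_true]
    ring
  exact_mod_cast this

lemma la {ι : Type*} [Fintype ι] [DecidableEq ι] {n m : ℕ} (hm : 0 < m)
    (T : EuclideanSpace ℂ ι →ₗ[ℂ] (Fin n → ℂ)) (ψ : Fin m → ι → ℂ)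
    (hψ : ∀ l k, ∑ i, ψ i l * (starRingEnd ℂ) (ψ i k) = if l = k then (m : ℂ) else 0)
    (a : ι → ℝ) (E : ℝ) (hE : 0 ≤ E)
    (h : ∀ v : EuclideanSpace ℂ ι, T v = 0 → ‖v‖ ≤ 1 → ∀ i, ‖∑ k, (a k : ℂ) * ψ i k * v k‖ ≤ E) :
    ∃ c : ι → ℝ, (∀ k, 0 ≤ c k ∧ c k ≤ 1) ∧ ∑ k, c k ≤ n ∧ ∑ k, a k ^ 2 * (1 - c k) ≤ E ^ 2 := by
  let V := LinearMap.ker T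
  let r : Fin m → EuclideanSpace ℂ ι := fun i => WithLp.toLp 2 (fun k => (starRingEnd ℂ) (a k * ψ i k))
  have hr : ∀ i v, inner ℂ (r i) v = ∑ k, (a k : ℂ) * ψ i k * v k := by
    intro i v
    rw [PiLp.inner_apply]
    refine Finset.sum_congr rfl (fun k _ => ?_)
    rw [RCLike.inner_apply]
    simp [r]; ring
  let b := stdOrthonormalBasis ℂ Vᗮ
  have hdim : Module.finrank ℂ Vᗮ ≤ n := by
    have h1 := Submodule.finrank_add_finrank_orthogonal V
    have h2 := LinearMap.finrank_range_add_finrank_ker T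
    have h3 : Module.finrank ℂ (LinearMap.range T) ≤ n := by
      simpa using Submodule.finrank_le (LinearMap.range T)
    change Module.finrank ℂ (LinearMap.ker T) + _ = _ at h1
    omega
  have hbo : Orthonormal ℂ (fun q => (b q : EuclideanSpace ℂ ι)) :=
    b.orthonormal.comp_linearIsometry Vᗮ.subtypeₗᵢ
  have hPV : ∀ i, ‖V.starProjection (r i)‖ ≤ E := by
    intro i
    set v := V.starProjection (r i) with hv
    have hvm : v ∈ V := V.starProjection_apply_mem _
    by_cases h0 : ‖v‖ = 0
    · rw [h0]; exact hE
    have h1 := h (((‖v‖ : ℂ))⁻¹ • v) (V.smul_mem _ hvm) (by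
      rw [norm_smul, norm_inv, Complex.norm_real, norm_norm, inv_mul_cancel₀ h0]) i
    rw [← hr, inner_smul_right] at h1
    have h2 : inner ℂ (r i) v = (‖v‖ : ℂ) ^ 2 := by
      have : inner ℂ (r i - v) v = 0 := by
        rw [hv]
        exact V.starProjection_inner_eq_zero (r i) _ hvm
      rw [inner_sub_left, sub_eq_zero] at this
      rw [this]; exact inner_self_eq_norm_sq_to_K v
    rw [h2] at h1
    have h3 : ((‖v‖ : ℂ))⁻¹ * (‖v‖ : ℂ) ^ 2 = (‖v‖ : ℂ) := by
      have : (‖v‖ : ℂ) ≠ 0 := by exact_mod_cast h0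
      field_simp
    rw [h3, Complex.norm_real, norm_norm] at h1
    exact h1
  have hsplit : ∀ i, ‖r i‖ ^ 2 = ‖V.starProjection (r i)‖ ^ 2 +
      ∑ q, ‖∑ k, ((a k : ℂ) * (b q : EuclideanSpace ℂ ι) k) * ψ i k‖ ^ 2 := by
    intro i
    rw [V.norm_sq_eq_add_norm_sq_projection (r i)]
    congr 1
    rw [← b.sum_sq_norm_inner_right]
    refine Finset.sum_congr rfl (fun q _ => ?_)
    have : inner ℂ (b q) (Vᗮ.orthogonalProjectionOnto (r i)) = inner ℂ (b q : EuclideanSpace ℂ ι) (r i) := by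
      exact Vᗮ.inner_orthogonalProjectionOnto_eq_of_mem_left _ _
    rw [this, ← inner_conj_symm, RCLike.norm_conj, hr]
    congr 2
    exact Finset.sum_congr rfl (fun k _ => by ring)
  have hrn : ∑ i, ‖r i‖ ^ 2 = m * ∑ k, a k ^ 2 := by
    simp only [EuclideanSpace.norm_sq_eq]
    rw [Finset.sum_comm, Finset.mul_sum]
    refine Finset.sum_congr rfl (fun k _ => ?_)
    have : ((∑ i, ‖ψ i k‖ ^ 2 : ℝ) : ℂ) = ((m : ℝ) : ℂ) := by
      push_cast
      simp only [← Complex.mul_conj']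
      rw [hψ, if_pos rfl]
    have h' : ∑ i, ‖ψ i k‖ ^ 2 = (m : ℝ) := by exact_mod_cast this
    rw [← h', Finset.sum_mul]
    refine Finset.sum_congr rfl (fun i _ => ?_)
    simp [r, mul_pow]; ring
  refine ⟨fun k => ∑ q, ‖(b q : EuclideanSpace ℂ ι) k‖ ^ 2, fun k => ⟨by positivity, ?_⟩, ?_, ?_⟩
  · have := hbo.sum_inner_products_le (s := Finset.univ) (EuclideanSpace.single k (1 : ℂ))
    simpa [EuclideanSpace.inner_single_right] using this
  · rw [Finset.sum_comm]
    have : ∀ q, ∑ k, ‖(b q : EuclideanSpace ℂ ι) k‖ ^ 2 = 1 := by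
      intro q
      rw [← EuclideanSpace.norm_sq_eq, hbo.norm_eq_one q]; norm_num
    simp only [this]
    simpa using hdim
  · have hsum : (m : ℝ) * ∑ k, a k ^ 2 ≤ m * E ^ 2 + m * ∑ k, a k ^ 2 *
        ∑ q, ‖(b q : EuclideanSpace ℂ ι) k‖ ^ 2 := by
      rw [← hrn]
      simp only [hsplit, Finset.sum_add_distrib]
      refine add_le_add ?_ (le_of_eq ?_)
      · calc _ ≤ ∑ i : Fin m, E ^ 2 := Finset.sum_le_sum (fun i _ =>
              pow_le_pow_left₀ (norm_nonneg _) (hPV i) 2)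
          _ = _ := by simp
      · rw [Finset.sum_comm]
        simp only [parseval_fin ψ hψ]
        rw [← Finset.mul_sum, Finset.sum_comm]
        congr 1
        refine Finset.sum_congr rfl (fun k _ => ?_)
        rw [Finset.mul_sum]
        refine Finset.sum_congr rfl (fun q _ => ?_)
        rw [norm_mul, mul_pow, Complex.norm_real, Real.norm_eq_abs, sq_abs]
    have hm' : (0 : ℝ) < m := by exact_mod_cast hm
    rw [← mul_add] at hsum
    have := le_of_mul_le_mul_left hsum hm'
    simp only [mul_sub, mul_one, Finset.sum_sub_distrib]
    linarith

lemma all_lower {d : ℕ} (ω : (Fin d → ℤ) → ℝ) (K : Finset (Fin d → ℤ)) (n : ℕ)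
    (q : ℝ) (hq : 1 < q) :
    ENNReal.ofReal (Real.sqrt (∑ k ∈ K, ((ω k) ^ 2)⁻¹ -
      (∑ k ∈ K, (((ω k) ^ 2)⁻¹) ^ q) ^ (1 / q) * (n : ℝ) ^ (1 - 1 / q))) ≤ wcErr ω (allInfo d) n := by
  classical
  unfold wcErr
  refine le_iInf fun L => le_iInf fun hL => le_iInf fun φ => ?_
  set S := ⨆ (u : Coef d) (_ : ‖u‖ ≤ 1) (x : Fin d → ℝ) (_ : x ∈ cube d),
      (‖torusFn ω u x - φ (fun i => L i u) x‖₊ : ℝ≥0∞) with hS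
  by_cases hST : S = ⊤
  · rw [hST]; exact le_top
  obtain ⟨p, hpN, hp⟩ := Nat.exists_infinite_primes
    (K.card ^ 2 + 1 + ∑ k ∈ K, ∑ j, (2 * |k j|).toNat)
  have hcard : K.card ^ 2 < p := by omega
  have hbd : ∀ k ∈ K, ∀ j, 2 * |k j| < p := by
    intro k hk j
    have h1 : (2 * |k j|).toNat ≤ ∑ j, (2 * |k j|).toNat :=
      Finset.single_le_sum (f := fun j => (2 * |k j|).toNat) (fun _ _ => Nat.zero_le _) (Finset.mem_univ j)
    have h2 : ∑ j, (2 * |k j|).toNat ≤ ∑ k ∈ K, ∑ j, (2 * |k j|).toNat :=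
      Finset.single_le_sum (f := fun k : Fin d → ℤ => ∑ j, (2 * |k j|).toNat)
        (fun _ _ => Nat.zero_le _) hk
    have h3 := Int.self_le_toNat (2 * |k j|)
    omega
  obtain ⟨x, c, hx, hc, hort⟩ := lattice K p hp hcard hbd
  choose T hT using hL
  let J : EuclideanSpace ℂ K →ₗ[ℂ] Coef d :=
    { toFun := fun v => ∑ k : K, v k • (lp.single 2 (k : Fin d → ℤ) (1 : ℂ) : Coef d)
      map_add' := by
        intro v w
        simp [add_smul, Finset.sum_add_distrib]
      map_smul' := by
        intro a v
        simp [mul_smul, Finset.smul_sum] }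
  let f : EuclideanSpace ℂ K → (Fin d → ℤ) → ℂ := fun v k => if h : k ∈ K then v ⟨k, h⟩ else 0
  have hf : ∀ v (k : K), f v k = v k := by
    intro v k; simp [f]
  have hJ : ∀ v, J v = ∑ k ∈ K, (lp.single 2 k (f v k) : Coef d) := by
    intro v
    rw [← Finset.sum_coe_sort K (fun k => (lp.single 2 k (f v k) : Coef d))]
    refine Finset.sum_congr rfl (fun k _ => ?_)
    rw [hf, ← lp.single_smul, smul_eq_mul, mul_one]
  have hJn : ∀ v, ‖J v‖ = ‖v‖ := by
    intro v
    have h2 : (0 : ℝ) < (2 : ℝ≥0∞).toReal := by simp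
    have := lp.norm_sum_single (p := 2) h2 (f v) K
    rw [← hJ] at this
    simp only [ENNReal.toReal_ofNat, Real.rpow_ofNat] at this
    rw [← Finset.sum_coe_sort K] at this
    simp only [hf] at this
    rw [← EuclideanSpace.norm_sq_eq] at this
    exact (sq_eq_sq₀ (norm_nonneg _) (norm_nonneg _)).mp this
  have hJc : ∀ v l, (J v : (Fin d → ℤ) → ℂ) l = f v l := by
    intro v l
    rw [hJ, lp.coeFn_sum, Finset.sum_apply]
    simp only [lp.single_apply, Pi.single_apply]
    rw [Finset.sum_ite_eq K l]
    simp only [f]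
    split_ifs <;> rfl
  have hJt : ∀ v y, torusFn ω (J v) y = ∑ k : K, (((ω k)⁻¹ : ℝ) : ℂ) * ek k.1 y * v k := by
    intro v y
    rw [torusFn_eq, tsum_eq_sum (s := K)]
    · rw [← Finset.sum_coe_sort K]
      refine Finset.sum_congr rfl (fun k _ => ?_)
      rw [hJc, hf]; push_cast; rfl
    · intro l hl
      rw [hJc]; simp [f, hl]
  let TT : EuclideanSpace ℂ K →ₗ[ℂ] (Fin n → ℂ) := LinearMap.pi (fun i => (T i).toLinearMap ∘ₗ J)
  obtain ⟨cc, hc01, hcs, hcE⟩ := la hp.pos TT (fun i (k : K) => ek k.1 (x i)) (by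
      intro l k
      rw [hort]
      have : c l.1 = c k.1 ↔ l = k := by
        rw [hc.eq_iff l.2 k.2, Subtype.ext_iff]
      simp only [this]) (fun k => (ω k)⁻¹) S.toReal ENNReal.toReal_nonneg (by
      intro v hv hv1 i
      have key : ∀ w, ‖w‖ ≤ 1 → TT w = 0 → ‖torusFn ω (J w) (x i) - φ 0 (x i)‖ ≤ S.toReal := by
        intro w hw hw0
        have h1 : (‖torusFn ω (J w) (x i) - φ (fun i => L i (J w)) (x i)‖₊ : ℝ≥0∞) ≤ S :=
          le_iSup_of_le (J w) (le_iSup_of_le (by rw [hJn]; exact hw)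
            (le_iSup_of_le (x i) (le_iSup_of_le (hx i) le_rfl)))
        have h2 : (fun i => L i (J w)) = 0 := by
          funext q
          rw [hT q]
          exact congrFun hw0 q
        rw [h2, nn_coe] at h1
        exact (ENNReal.ofReal_le_iff_le_toReal hST).mp h1
      have k1 := key v hv1 hv
      have k2 := key (-v) (by rwa [norm_neg]) (by rw [map_neg, hv, neg_zero])
      have hn : torusFn ω (J (-v)) (x i) = - torusFn ω (J v) (x i) := by
        rw [hJt, hJt, ← Finset.sum_neg_distrib]
        exact Finset.sum_congr rfl (fun k _ => by simp)
      rw [← hJt]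
      rw [hn] at k2
      have e : (2 : ℂ) * torusFn ω (J v) (x i) = (torusFn ω (J v) (x i) - φ 0 (x i)) -
          (-torusFn ω (J v) (x i) - φ 0 (x i)) := by ring
      have e2 := norm_sub_le (torusFn ω (J v) (x i) - φ 0 (x i)) (-torusFn ω (J v) (x i) - φ 0 (x i))
      rw [← e, norm_mul] at e2
      simp only [Complex.norm_ofNat] at e2
      linarith)
  rw [ENNReal.ofReal_le_iff_le_toReal hST]
  rw [Real.sqrt_le_left ENNReal.toReal_nonneg]
  refine le_trans ?_ hcE
  simp only [mul_sub, mul_one, Finset.sum_sub_distrib, inv_pow]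
  rw [Finset.sum_coe_sort K (fun k => ((ω k) ^ 2)⁻¹)]
  refine sub_le_sub_left ?_ _
  have hconj : q.HolderConjugate (1 - 1 / q)⁻¹ := by
    rw [Real.holderConjugate_iff]
    refine ⟨hq, ?_⟩
    rw [inv_inv]; ring
  have hq' : 1 ≤ (1 - 1 / q)⁻¹ := hconj.symm.lt.le
  have := Real.inner_le_Lp_mul_Lq Finset.univ (fun k : K => ((ω k) ^ 2)⁻¹) cc hconj
  refine this.trans ?_
  have e1 : ∑ i : K, |((ω i) ^ 2)⁻¹| ^ q = ∑ k ∈ K, (((ω k) ^ 2)⁻¹) ^ q := by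
    rw [← Finset.sum_coe_sort K]
    exact Finset.sum_congr rfl (fun k _ => by rw [abs_of_nonneg (by positivity)])
  rw [e1]
  refine mul_le_mul_of_nonneg_left ?_ (Real.rpow_nonneg (Finset.sum_nonneg (fun k _ => by positivity)) _)
  rw [one_div (1 - 1 / q)⁻¹, inv_inv]
  refine Real.rpow_le_rpow (Finset.sum_nonneg (fun k _ => by positivity)) ?_ ?_
  · refine le_trans (Finset.sum_le_sum (fun k _ => ?_)) hcs
    rw [abs_of_nonneg (hc01 k).1]
    exact (Real.rpow_le_rpow_of_exponent_ge' (hc01 k).1 (hc01 k).2 zero_le_one hq').trans_eq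
      (Real.rpow_one _)
  · rw [sub_nonneg, div_le_one (by linarith)]; exact hq.le


def mu (g r : ℕ → ℝ) (j : ℕ) (h : ℤ) : ℝ :=
  if h = 0 then 1 else g (j + 1) * |(h : ℝ)| ^ (-(2 * r (j + 1)))

structure KorHyp (g r : ℕ → ℝ) : Prop where
  pos : ∀ j, 1 ≤ j → 0 < g j
  le_one : ∀ j, 1 ≤ j → g j ≤ 1
  anti : ∀ i j, 1 ≤ i → i ≤ j → g j ≤ g i
  r1 : 1 / 2 < r 1
  rmono : ∀ j, 1 ≤ j → r 1 ≤ r j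

lemma korHyp_of (g r : ℕ → ℝ)
    (hg1 : g 1 ≤ 1) (hgpos : ∀ j, 1 ≤ j → 0 < g j)
    (hgmono : ∀ j, 1 ≤ j → g (j + 1) ≤ g j)
    (hr1 : 1 / 2 < r 1) (hrmono : ∀ j, 1 ≤ j → r j ≤ r (j + 1)) : KorHyp g r := by
  have anti : ∀ i j, 1 ≤ i → i ≤ j → g j ≤ g i := by
    intro i j hi hij
    induction j, hij using Nat.le_induction with
    | base => exact le_rfl
    | succ n hn ih => exact (hgmono n (by omega)).trans ih
  refine ⟨hgpos, fun j hj => (anti 1 j le_rfl hj).trans hg1, anti, hr1, ?_⟩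
  intro j hj
  induction j, hj using Nat.le_induction with
  | base => exact le_rfl
  | succ n hn ih => exact ih.trans (hrmono n hn)

lemma mu_pos {g r : ℕ → ℝ} (H : KorHyp g r) (j : ℕ) (h : ℤ) : 0 < mu g r j h := by
  unfold mu
  split_ifs with h0
  · exact one_pos
  · have : (0 : ℝ) < |(h : ℝ)| := abs_pos.mpr (by exact_mod_cast h0)
    have := H.pos (j + 1) (by omega)
    positivity

lemma one_le_abs {h : ℤ} (h0 : h ≠ 0) : (1 : ℝ) ≤ |(h : ℝ)| := by
  exact_mod_cast Int.one_le_abs h0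

lemma mu_le_inv {g r : ℕ → ℝ} (H : KorHyp g r) (j : ℕ) (h : ℤ) (h0 : h ≠ 0) :
    mu g r j h ≤ |(h : ℝ)|⁻¹ := by
  rw [mu, if_neg h0]
  have h1 := one_le_abs h0
  have hr := H.rmono (j + 1) (by omega)
  have h2 : |(h : ℝ)| ^ (-(2 * r (j + 1))) ≤ |(h : ℝ)| ^ (-1 : ℝ) :=
    Real.rpow_le_rpow_of_exponent_le h1 (by linarith [H.r1])
  rw [Real.rpow_neg_one] at h2
  exact (mul_le_of_le_one_left (by positivity) (H.le_one _ (by omega))).trans h2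

lemma mu_le_one {g r : ℕ → ℝ} (H : KorHyp g r) (j : ℕ) (h : ℤ) : mu g r j h ≤ 1 := by
  by_cases h0 : h = 0
  · simp [mu, h0]
  · exact (mu_le_inv H j h h0).trans (inv_le_one_of_one_le₀ (one_le_abs h0))

lemma lam_eq {g r : ℕ → ℝ} (H : KorHyp g r) (d : ℕ) (k : Fin d → ℤ) :
    ((korWeight g r d k) ^ 2)⁻¹ = ∏ j : Fin d, mu g r j (k j) := by
  unfold korWeight
  rw [Real.sq_sqrt, ← Finset.prod_inv_distrib]
  · refine Finset.prod_congr rfl (fun j _ => ?_)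
    unfold mu
    split_ifs
    · simp
    · rw [mul_inv, inv_inv, Real.rpow_neg (abs_nonneg _)]
  · refine Finset.prod_nonneg (fun j _ => ?_)
    have := H.pos (j + 1) (by omega)
    split_ifs <;> positivity

lemma korWeight_zero (g r : ℕ → ℝ) (d : ℕ) : korWeight g r d 0 = 1 := by
  simp [korWeight]

lemma sum_box {g r : ℕ → ℝ} (H : KorHyp g r) (d : ℕ) (q : ℝ) (t : Fin d → Finset ℤ) :
    ∑ k ∈ Fintype.piFinset t, (((korWeight g r d k) ^ 2)⁻¹) ^ q
      = ∏ j : Fin d, ∑ h ∈ t j, (mu g r j h) ^ q := by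
  rw [Finset.prod_univ_sum]
  refine Finset.sum_congr rfl (fun k _ => ?_)
  rw [lam_eq H, Real.finsetProd_rpow]
  exact fun j _ => (mu_pos H _ _).le

lemma sum_mu_le {g r : ℕ → ℝ} (H : KorHyp g r) (α q : ℝ) (hα : 1 < α) (hq : 0 < q)
    (hαq : α ≤ 2 * r 1 * q) (j : ℕ) (t : Finset ℤ) :
    ∑ h ∈ t, (mu g r j h) ^ q ≤ 1 + (∑' h : ℤ, |(h : ℝ)| ^ (-α)) * g (j + 1) ^ q := by
  have hs := Real.summable_abs_int_rpow hα
  have hg := H.pos (j + 1) (by omega)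
  have h1 : ∀ h ∈ t, (mu g r j h) ^ q ≤ (if h = 0 then (1 : ℝ) else 0) +
      |(h : ℝ)| ^ (-α) * g (j + 1) ^ q := by
    intro h _
    unfold mu
    split_ifs with h0
    · rw [Real.one_rpow]
      have : 0 ≤ |(h : ℝ)| ^ (-α) * g (j + 1) ^ q := by positivity
      linarith
    · rw [Real.mul_rpow hg.le (by positivity), ← Real.rpow_mul (abs_nonneg _), zero_add, mul_comm]
      refine mul_le_mul_of_nonneg_right ?_ (by positivity)
      refine Real.rpow_le_rpow_of_exponent_le (one_le_abs h0) ?_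
      have := H.rmono (j + 1) (by omega)
      nlinarith
  refine (Finset.sum_le_sum h1).trans ?_
  rw [Finset.sum_add_distrib, ← Finset.sum_mul]
  refine add_le_add ?_ ?_
  · rw [Finset.sum_ite_eq' t (0 : ℤ)]
    split_ifs <;> norm_num
  · exact mul_le_mul_of_nonneg_right (hs.sum_le_tsum _ (fun h _ => by positivity)) (by positivity)

lemma sum_lam_le {g r : ℕ → ℝ} (H : KorHyp g r) (α q : ℝ) (hα : 1 < α) (hq : 0 < q)
    (hαq : α ≤ 2 * r 1 * q) (d : ℕ) (F : Finset (Fin d → ℤ)) :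
    ∑ k ∈ F, (((korWeight g r d k) ^ 2)⁻¹) ^ q ≤
      ∏ j : Fin d, (1 + (∑' h : ℤ, |(h : ℝ)| ^ (-α)) * g (j + 1) ^ q) := by
  classical
  have hsub : F ⊆ Fintype.piFinset (fun j => F.image (fun k => k j)) := by
    intro k hk
    rw [Fintype.mem_piFinset]
    exact fun j => Finset.mem_image_of_mem _ hk
  refine (Finset.sum_le_sum_of_subset_of_nonneg hsub (fun k _ _ => by positivity)).trans ?_
  rw [sum_box H]
  refine Finset.prod_le_prod (fun j _ => Finset.sum_nonneg (fun h _ => ?_))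
    (fun j _ => sum_mu_le H α q hα hq hαq _ _)
  exact Real.rpow_nonneg (mu_pos H _ _).le _

lemma lam_summable {g r : ℕ → ℝ} (H : KorHyp g r) (d : ℕ) :
    Summable (fun k => ((korWeight g r d k) ^ 2)⁻¹) := by
  refine summable_of_sum_le (fun k => by positivity) (fun F => ?_)
    (c := ∏ j : Fin d, (1 + (∑' h : ℤ, |(h : ℝ)| ^ (-(2 * r 1))) * g (j + 1) ^ (1 : ℝ)))
  have := sum_lam_le H (2 * r 1) 1 (by linarith [H.r1]) one_pos (by linarith) d F
  simpa only [Real.rpow_one] using this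

lemma std_bound_aux {g r : ℕ → ℝ} (H : KorHyp g r) (d : ℕ) (q S ε : ℝ) (hq0 : 0 < q) (hq1 : q < 1)
    (hS1 : 1 ≤ S) (hε : 0 < ε) (hε1 : ε < 1)
    (hS : ∀ F : Finset (Fin d → ℤ), ∑ k ∈ F, (((korWeight g r d k) ^ 2)⁻¹) ^ q ≤ S) :
    ∃ n : ℕ, wcErr (korWeight g r d) (stdInfo (korWeight g r d)) n ≤ ENNReal.ofReal ε ∧
      1 ≤ n ∧ Real.log n ≤ 3 + 2 / (1 - q) * (2 + Real.log S + 2 * Real.log ε⁻¹) := by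
  classical
  set lam : (Fin d → ℤ) → ℝ := fun k => ((korWeight g r d k) ^ 2)⁻¹ with hlam
  have hlpos : ∀ k, 0 < lam k := by
    intro k
    simp only [hlam]
    rw [lam_eq H]; exact Finset.prod_pos (fun j _ => mu_pos H _ _)
  have hη : 0 < 1 - q := by linarith
  set Z := 4 * S / ε ^ 2 with hZ
  have hε2 : ε ^ 2 ≤ 1 := by nlinarith
  have hZS : S ≤ Z := by
    rw [hZ, le_div_iff₀ (by positivity)]
    nlinarith
  have hZpos : 0 < Z := by linarith
  set Y := Z ^ (1 / (1 - q)) with hY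
  have hYpos : 0 < Y := Real.rpow_pos_of_pos hZpos _
  have hY1 : 1 ≤ Y := Real.one_le_rpow (by linarith) (by positivity)
  have hYη : Y ^ (1 - q) = Z := by
    rw [hY, ← Real.rpow_mul hZpos.le, one_div, inv_mul_cancel₀ hη.ne', Real.rpow_one]
  have hsum : Summable (fun k => lam k ^ q) :=
    summable_of_sum_le (fun k => Real.rpow_nonneg (hlpos k).le _) hS
  have hfin : {k | ¬ (lam k ^ q < (Y⁻¹) ^ q)}.Finite :=
    hsum.tendsto_cofinite_zero.eventually (gt_mem_nhds (by positivity))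
  set K := hfin.toFinset with hK
  have hKm : ∀ k, k ∈ K ↔ Y⁻¹ ≤ lam k := by
    intro k
    rw [hK, Set.Finite.mem_toFinset, Set.mem_ofPred_eq, not_lt,
      Real.rpow_le_rpow_iff (by positivity) (hlpos k).le hq0]
  have hcard : (K.card : ℝ) ≤ Y := by
    have h1 : (K.card : ℝ) * (Y⁻¹) ^ q ≤ S := by
      refine le_trans ?_ (hS K)
      rw [← nsmul_eq_mul]
      refine Finset.card_nsmul_le_sum _ _ _ (fun k hk => ?_)
      exact Real.rpow_le_rpow (by positivity) ((hKm k).mp hk) hq0.le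
    have h2 : Y ^ (1 - q) * Y ^ q = Y := by
      rw [← Real.rpow_add hYpos]; simp
    rw [Real.inv_rpow hYpos.le, ← div_eq_mul_inv, div_le_iff₀ (by positivity)] at h1
    calc (K.card : ℝ) ≤ S * Y ^ q := h1
      _ ≤ Y ^ (1 - q) * Y ^ q := by rw [hYη]; gcongr
      _ = Y := h2
  have hcoord : ∀ k ∈ K, ∀ j, |(k j : ℝ)| ≤ Y := by
    intro k hk j
    by_cases h0 : k j = 0
    · simp [h0, hYpos.le]
    have h1 := (hKm k).mp hk
    have h2 : lam k ≤ |(k j : ℝ)|⁻¹ := by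
      simp only [hlam]
      rw [lam_eq H, ← Finset.mul_prod_erase _ _ (Finset.mem_univ j)]
      refine (mul_le_of_le_one_right (mu_pos H _ _).le ?_).trans (mu_le_inv H _ _ h0)
      exact Finset.prod_le_one (fun i _ => (mu_pos H _ _).le) (fun i _ => mu_le_one H _ _)
    have h3 := one_le_abs h0
    exact (inv_le_inv₀ hYpos (by linarith)).mp (h1.trans h2)
  have hceil := Nat.le_ceil (4 * Y ^ 2)
  have hceil' := (Nat.ceil_lt_add_one (a := 4 * Y ^ 2) (by positivity)).le
  obtain ⟨p, hp, hNp, hp2⟩ := Nat.exists_prime_lt_and_le_two_mul ⌈4 * Y ^ 2⌉₊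
    (by rw [Ne, Nat.ceil_eq_zero, not_le]; positivity)
  have hNp' : ((⌈4 * Y ^ 2⌉₊ : ℕ) : ℝ) < p := by exact_mod_cast hNp
  have hp2' : (p : ℝ) ≤ 2 * (⌈4 * Y ^ 2⌉₊ : ℕ) := by exact_mod_cast hp2
  refine ⟨p, ?_, hp.one_le, ?_⟩
  · refine std_upper _ (lam_summable H d) K p hp ?_ ?_ ε hε.le ?_
    · have : ((K.card ^ 2 : ℕ) : ℝ) < p := by
        push_cast
        have : (K.card : ℝ) ^ 2 ≤ Y ^ 2 := by gcongr
        nlinarith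
      exact_mod_cast this
    · intro k hk j
      have : (2 * |(k j : ℝ)| : ℝ) < p := by
        have := hcoord k hk j
        nlinarith
      exact_mod_cast this
    · intro F hF
      have h1 : ∀ k ∈ F, lam k ≤ (Y⁻¹) ^ (1 - q) * lam k ^ q := by
        intro k hk
        have h2 : lam k < Y⁻¹ := by
          by_contra hc
          exact hF k hk ((hKm k).mpr (not_lt.mp hc))
        calc lam k = lam k ^ (1 - q) * lam k ^ q := by
              rw [← Real.rpow_add (hlpos k)]; simp
          _ ≤ _ := mul_le_mul_of_nonneg_right
              (Real.rpow_le_rpow (hlpos k).le h2.le hη.le) (Real.rpow_nonneg (hlpos k).le _)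
      have h3 : ∑ k ∈ F, lam k ≤ (Y⁻¹) ^ (1 - q) * S := by
        refine (Finset.sum_le_sum h1).trans ?_
        rw [← Finset.mul_sum]
        exact mul_le_mul_of_nonneg_left (hS F) (by positivity)
      rw [Real.inv_rpow hYpos.le, hYη] at h3
      have h4 : 4 * (Z⁻¹ * S) = ε ^ 2 := by
        rw [hZ]; field_simp
      change 4 * ∑ k ∈ F, lam k ≤ ε ^ 2
      linarith
  · have hp10 : (p : ℝ) ≤ 10 * Y ^ 2 := by nlinarith
    have hp0 : (0 : ℝ) < p := by exact_mod_cast hp.pos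
    have hlog := Real.log_le_log hp0 hp10
    rw [Real.log_mul (by norm_num) (by positivity), Real.log_pow, hY, Real.log_rpow hZpos, hZ,
      Real.log_div (by positivity) (by positivity), Real.log_mul (by norm_num) (by positivity),
      Real.log_pow] at hlog
    have l2 := Real.log_two_lt_d9
    have l4 : Real.log 4 ≤ 2 := by
      rw [show (4 : ℝ) = 2 ^ 2 by norm_num, Real.log_pow]; push_cast; linarith
    have l10 : Real.log 10 ≤ 3 := by
      have : Real.log 10 ≤ Real.log (2 ^ 4) := Real.log_le_log (by norm_num) (by norm_num)
      rw [Real.log_pow] at this; push_cast at this; linarith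
    rw [Real.log_inv]
    push_cast at hlog
    have : 1 / (1 - q) * (Real.log 4 + Real.log S - 2 * Real.log ε) ≤
        1 / (1 - q) * (2 + Real.log S + 2 * -Real.log ε) := by
      refine mul_le_mul_of_nonneg_left (by linarith) (by positivity)
    have e : 2 / (1 - q) * (2 + Real.log S + 2 * -Real.log ε) =
      2 * (1 / (1 - q) * (2 + Real.log S + 2 * -Real.log ε)) := by ring
    rw [e]; linarith


lemma gq_bound (g d η : ℝ) (hg : 0 < g) (hd : 1 ≤ d) (hη0 : 0 ≤ η) (hη1 : η ≤ 1)
    (hηd : η * Real.log d ≤ 1) : g ^ (1 - η) ≤ Real.exp 1 * (g + 1 / d) := by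
  have hd0 : 0 < d := by linarith
  have hw : 0 < g + 1 / d := by positivity
  have h1 : g ^ (1 - η) ≤ (g + 1 / d) ^ (1 - η) :=
    Real.rpow_le_rpow hg.le (by have : 0 < 1 / d := by positivity
                                linarith) (by linarith)
  have h2 : (g + 1 / d) ^ (1 - η) = (g + 1 / d) ^ (-η) * (g + 1 / d) := by
    conv_rhs => rw [← Real.rpow_add_one hw.ne']
    congr 1; ring
  have h3 : (g + 1 / d) ^ (-η) ≤ Real.exp 1 := by
    have : (g + 1 / d) ^ (-η) ≤ (1 / d) ^ (-η) :=
      Real.rpow_le_rpow_of_nonpos (by positivity) (by linarith) (by linarith)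
    refine this.trans ?_
    rw [one_div, Real.inv_rpow hd0.le, Real.rpow_neg hd0.le, inv_inv, Real.rpow_def_of_pos hd0]
    exact Real.exp_le_exp.mpr (by linarith)
  rw [h2] at h1
  exact h1.trans (mul_le_mul_of_nonneg_right h3 hw.le)

lemma std_bound {g r : ℕ → ℝ} (H : KorHyp g r) : ∃ A > (0 : ℝ), ∀ d : ℕ, 0 < d →
    ∀ ε ∈ Set.Ioo (0 : ℝ) 1,
    ∃ n : ℕ, wcErr (korWeight g r d) (stdInfo (korWeight g r d)) n ≤ ENNReal.ofReal ε ∧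
      1 ≤ n ∧ Real.log n ≤ A * ((1 + Real.log d) *
        (1 + ∑ j ∈ Finset.range d, g (j + 1) + Real.log ε⁻¹)) := by
  have hr := H.r1
  have hr0 : 0 < r 1 := by linarith
  set c := 1 / 2 - 1 / (4 * r 1) with hc
  have hc0 : 0 < c := by
    have : 1 / (4 * r 1) < 1 / 2 := by
      rw [div_lt_div_iff₀ (by positivity) (by norm_num)]; linarith
    linarith
  have hc1 : c < 1 / 2 := by
    have : 0 < 1 / (4 * r 1) := by positivity
    linarith
  have hα : (1 : ℝ) < r 1 + 1 / 2 := by linarith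
  set C := ∑' h : ℤ, |(h : ℝ)| ^ (-(r 1 + 1 / 2)) with hC
  have hC0 : 0 ≤ C := tsum_nonneg (fun h => by positivity)
  refine ⟨3 + 2 / c * (2 + C * Real.exp 1), by positivity, ?_⟩
  intro d hd ε ⟨hε0, hε1⟩
  have hd1 : (1 : ℝ) ≤ d := by exact_mod_cast hd
  have hld : 0 ≤ Real.log d := Real.log_nonneg hd1
  set η := c / (1 + Real.log d) with hη
  have hη0 : 0 < η := by positivity
  have hηc : η ≤ c := div_le_self hc0.le (by linarith)
  have hηd : η * Real.log d ≤ 1 := by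
    rw [hη, div_mul_eq_mul_div, div_le_one (by positivity)]
    nlinarith
  have hαq : r 1 + 1 / 2 ≤ 2 * r 1 * (1 - η) := by
    have : 2 * r 1 * (1 - c) = r 1 + 1 / 2 := by
      rw [hc]; field_simp; ring
    rw [← this]
    have : 0 < 2 * r 1 := by linarith
    nlinarith
  have hgp : ∀ j : ℕ, 0 < g (j + 1) := fun j => H.pos _ (by omega)
  set S := ∏ j : Fin d, (1 + C * g (j + 1) ^ (1 - η)) with hS
  have hS1 : 1 ≤ S := by
    rw [hS]
    calc (1 : ℝ) = ∏ _j : Fin d, (1 : ℝ) := by simp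
      _ ≤ _ := Finset.prod_le_prod (fun _ _ => zero_le_one) (fun j _ => by
        have : 0 ≤ C * g (j + 1) ^ (1 - η) := mul_nonneg hC0 (Real.rpow_nonneg (hgp _).le _)
        linarith)
  obtain ⟨n, hn, hn1, hlog⟩ := std_bound_aux H d (1 - η) S ε (by linarith) (by linarith) hS1 hε0 hε1
    (fun F => sum_lam_le H _ _ hα (by linarith) hαq d F)
  refine ⟨n, hn, hn1, hlog.trans ?_⟩
  have hlS : Real.log S ≤ C * Real.exp 1 * (1 + ∑ j ∈ Finset.range d, g (j + 1)) := by
    rw [hS, Real.log_prod (fun j _ => by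
      have : 0 ≤ C * g (j + 1) ^ (1 - η) := mul_nonneg hC0 (Real.rpow_nonneg (hgp _).le _)
      linarith)]
    calc _ ≤ ∑ j : Fin d, C * (Real.exp 1 * (g (j + 1) + 1 / d)) := by
          refine Finset.sum_le_sum (fun j _ => ?_)
          have h0 : 0 ≤ C * g (j + 1) ^ (1 - η) := mul_nonneg hC0 (Real.rpow_nonneg (hgp _).le _)
          have h1 := Real.log_le_sub_one_of_pos (x := 1 + C * g (j + 1) ^ (1 - η)) (by linarith)
          have h2 := mul_le_mul_of_nonneg_left (gq_bound (g (j + 1)) d η (hgp _) hd1 hη0.le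
            (by linarith) hηd) hC0
          linarith
      _ = C * Real.exp 1 * (∑ j : Fin d, g (j + 1) + ∑ j : Fin d, (1 / d : ℝ)) := by
          rw [← Finset.mul_sum, ← Finset.mul_sum, Finset.sum_add_distrib]; ring
      _ = _ := by
          rw [Finset.sum_range (fun j => g (j + 1))]
          simp only [Finset.sum_const, Finset.card_univ, Fintype.card_fin, nsmul_eq_mul]
          rw [mul_one_div_cancel (by positivity)]; ring
  set G := ∑ j ∈ Finset.range d, g (j + 1) with hG
  have hG0 : 0 ≤ G := Finset.sum_nonneg (fun j _ => (hgp j).le)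
  set le := Real.log ε⁻¹ with hle
  have hle0 : 0 ≤ le := Real.log_nonneg (by rw [one_le_inv₀ hε0]; exact hε1.le)
  have e1 : 2 / (1 - (1 - η)) = 2 / c * (1 + Real.log d) := by
    rw [sub_sub_cancel, hη]; field_simp
  rw [e1]
  have hCe : 0 ≤ C * Real.exp 1 := by positivity
  have h1 : 2 + Real.log S + 2 * le ≤ (2 + C * Real.exp 1) * (1 + G + le) := by nlinarith
  have h2 : (1 : ℝ) ≤ (1 + Real.log d) * (1 + G + le) := by nlinarith
  have h3 : 2 / c * (1 + Real.log d) * (2 + Real.log S + 2 * le) ≤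
      2 / c * (1 + Real.log d) * ((2 + C * Real.exp 1) * (1 + G + le)) :=
    mul_le_mul_of_nonneg_left h1 (by positivity)
  calc _ ≤ 3 * ((1 + Real.log d) * (1 + G + le)) +
        2 / c * (1 + Real.log d) * ((2 + C * Real.exp 1) * (1 + G + le)) := by linarith
    _ = _ := by ring

lemma korNC_le {g r : ℕ → ℝ} (H : KorHyp g r) (useStd : Bool) (crit : Crit) (d n : ℕ) (ε : ℝ)
    (h : wcErr (korWeight g r d) (stdInfo (korWeight g r d)) n ≤ ENNReal.ofReal ε) :
    korNC g r useStd crit d ε ≤ n ∧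
    wcErr (korWeight g r d) (allInfo d) (korNC g r useStd crit d ε) ≤
      ENNReal.ofReal ε * CRI (korWeight g r d) crit := by
  have hsub := std_sub_all _ (lam_summable H d)
  have hc : 1 ≤ CRI (korWeight g r d) crit := by
    cases crit
    · exact le_rfl
    · exact one_le_initErr _ (korWeight_zero g r d)
  have hmem : n ∈ {n : ℕ | wcErr (korWeight g r d) (if useStd then stdInfo (korWeight g r d)
      else allInfo d) n ≤ ENNReal.ofReal ε * CRI (korWeight g r d) crit} := by
    have h1 : wcErr (korWeight g r d) (if useStd then stdInfo (korWeight g r d)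
      else allInfo d) n ≤ ENNReal.ofReal ε := by
      cases useStd
      · exact (wcErr_anti _ hsub n).trans h
      · exact h
    exact h1.trans (le_mul_of_one_le_right (zero_le) hc)
  refine ⟨Nat.sInf_le hmem, ?_⟩
  have h2 := Nat.sInf_mem ⟨n, hmem⟩
  refine le_trans ?_ h2
  refine wcErr_anti _ ?_ _
  cases useStd
  · exact le_rfl
  · exact hsub

lemma one_add_log_le (a y : ℝ) (ha : 0 < a) (hy : 1 ≤ y) :
    1 + Real.log y ≤ (1 + 1 / a) * y ^ a := by
  have h1 := Real.log_le_rpow_div (x := y) (by linarith) ha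
  have h2 : 1 ≤ y ^ a := Real.one_le_rpow hy ha.le
  have : (1 + 1 / a) * y ^ a = y ^ a + y ^ a / a := by ring
  linarith

lemma logsq_le (a δ : ℝ) (ha : 0 < a) (hδ : 0 < δ) :
    ∃ C : ℝ, 0 ≤ C ∧ ∀ y : ℝ, 1 ≤ y → (1 + Real.log y) ^ 2 ≤ δ * y ^ a + C := by
  set K := 1 + 1 / (a / 4) with hK
  refine ⟨K ^ 4 / (4 * δ), by positivity, fun y hy => ?_⟩
  have h1 := one_add_log_le (a / 4) y (by positivity) hy
  have hl := Real.log_nonneg hy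
  have h2 : (1 + Real.log y) ^ 2 ≤ (K * y ^ (a / 4)) ^ 2 := pow_le_pow_left₀ (by linarith) h1 2
  have h3 : y ^ a = ((y ^ (a / 4)) ^ 2) ^ 2 := by
    rw [← pow_mul, ← Real.rpow_mul_natCast (by linarith)]; congr 1; push_cast; ring
  rw [h3]
  set z := (y ^ (a / 4)) ^ 2
  refine h2.trans ?_
  rw [mul_pow]
  change K ^ 2 * z ≤ δ * z ^ 2 + _
  have e : δ * z ^ 2 + K ^ 4 / (4 * δ) - K ^ 2 * z = (2 * δ * z - K ^ 2) ^ 2 / (4 * δ) := by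
    field_simp; ring
  have : 0 ≤ (2 * δ * z - K ^ 2) ^ 2 / (4 * δ) := by positivity
  linarith

lemma sum_rpow_le (a : ℝ) (ha : 0 < a) (ha1 : a ≤ 1) (d : ℕ) :
    ∑ j ∈ Finset.range d, ((j + 1 : ℕ) : ℝ) ^ (a - 1) ≤ (d : ℝ) ^ a / a := by
  induction d with
  | zero => simp [Real.zero_rpow ha.ne']
  | succ d ih =>
    rw [Finset.sum_range_succ]
    have hD : (0 : ℝ) < ((d + 1 : ℕ) : ℝ) := by positivity
    set D : ℝ := ((d + 1 : ℕ) : ℝ) with hDdef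
    have hd : (d : ℝ) = D * (1 + (-(1 / D))) := by
      rw [mul_add, mul_neg, mul_one_div_cancel hD.ne', hDdef]; push_cast; ring
    have h1D : 1 / D ≤ 1 := by
      rw [div_le_one hD, hDdef]; exact_mod_cast Nat.succ_le_succ (Nat.zero_le d)
    have h1 := rpow_one_add_le_one_add_mul_self (s := -(1 / D)) (by linarith) ha.le ha1
    have h2 : (d : ℝ) ^ a ≤ D ^ a * (1 + a * (-(1 / D))) := by
      rw [hd, Real.mul_rpow hD.le (by linarith)]
      exact mul_le_mul_of_nonneg_left h1 (by positivity)
    have h3 : D ^ (a - 1) = D ^ a / D := Real.rpow_sub_one hD.ne' a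
    rw [h3]
    have h4 : (d : ℝ) ^ a / a ≤ D ^ a * (1 + a * (-(1 / D))) / a := by gcongr
    have h5 : D ^ a * (1 + a * (-(1 / D))) / a = D ^ a / a - D ^ a / D := by
      field_simp; ring
    linarith


lemma term_bound {g r : ℕ → ℝ} (H : KorHyp g r) (t : ℝ) (ht0 : 0 < t) (ht1 : t < 1)
    (hT : Tendsto (fun j : ℕ => (j : ℝ) ^ (1 - t) * g j * lnplus (1 / g j)) atTop (nhds 0))
    (δ : ℝ) (hδ : 0 < δ) : ∃ J : ℕ, ∀ i : ℕ, J ≤ i → 1 ≤ i →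
      g i * (1 + Real.log i) ≤ δ * (i : ℝ) ^ (t - 1) := by
  set δ' := min 1 (δ / (1 + 1 / (1 - t))) with hδ'
  have ht : 0 < 1 - t := by linarith
  have hδ'0 : 0 < δ' := by
    rw [hδ']; exact lt_min one_pos (by positivity)
  obtain ⟨J, hJ⟩ := eventually_atTop.mp (hT.eventually (gt_mem_nhds hδ'0))
  refine ⟨J, fun i hi hi1 => ?_⟩
  have h := hJ i hi
  have hi0 : (0 : ℝ) < i := by exact_mod_cast hi1
  have hi1' : (1 : ℝ) ≤ i := by exact_mod_cast hi1
  have hg := H.pos i hi1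
  have hP : 0 < (i : ℝ) ^ (1 - t) := by positivity
  have hinv : (i : ℝ) ^ (t - 1) = ((i : ℝ) ^ (1 - t))⁻¹ := by
    rw [← Real.rpow_neg hi0.le]; congr 1; ring
  have hL1 : 1 ≤ lnplus (1 / g i) := le_max_left _ _
  have hL2 : Real.log (1 / g i) ≤ lnplus (1 / g i) := le_max_right _ _
  have hPg : (i : ℝ) ^ (1 - t) * g i ≤ 1 := by
    have h1 : δ' ≤ 1 := min_le_left _ _
    have : 0 < (i : ℝ) ^ (1 - t) * g i := by positivity
    nlinarith
  have hlog : (1 - t) * Real.log i ≤ lnplus (1 / g i) := by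
    refine le_trans ?_ hL2
    rw [← Real.log_rpow hi0]
    refine Real.log_le_log hP ?_
    rw [le_div_iff₀ hg]; exact hPg
  have h1 : 1 + Real.log i ≤ (1 + 1 / (1 - t)) * lnplus (1 / g i) := by
    have : Real.log i ≤ 1 / (1 - t) * lnplus (1 / g i) := by
      rw [one_div, inv_mul_eq_div, le_div_iff₀ ht]; linarith
    linarith
  rw [hinv, ← div_eq_mul_inv, le_div_iff₀ hP]
  have h2 : δ' ≤ δ / (1 + 1 / (1 - t)) := min_le_right _ _
  have hK : 0 < 1 + 1 / (1 - t) := by positivity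
  calc g i * (1 + Real.log i) * (i : ℝ) ^ (1 - t)
      ≤ g i * ((1 + 1 / (1 - t)) * lnplus (1 / g i)) * (i : ℝ) ^ (1 - t) := by gcongr
    _ = (1 + 1 / (1 - t)) * ((i : ℝ) ^ (1 - t) * g i * lnplus (1 / g i)) := by ring
    _ ≤ (1 + 1 / (1 - t)) * (δ / (1 + 1 / (1 - t))) := by gcongr; linarith
    _ = δ := by field_simp

lemma sum_bound {g r : ℕ → ℝ} (H : KorHyp g r) (t : ℝ) (ht0 : 0 < t) (ht1 : t < 1)
    (hT : Tendsto (fun j : ℕ => (j : ℝ) ^ (1 - t) * g j * lnplus (1 / g j)) atTop (nhds 0))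
    (δ : ℝ) (hδ : 0 < δ) : ∃ C : ℝ, 0 ≤ C ∧ ∀ d : ℕ, 0 < d →
      (1 + Real.log d) * ∑ j ∈ Finset.range d, g (j + 1) ≤ δ * (d : ℝ) ^ t + C := by
  set K := 1 + 1 / (t / 2) with hK
  have hK0 : 0 < K := by positivity
  set δ1 := δ / 2 / (K / (t / 2)) with hδ1
  have hδ10 : 0 < δ1 := by positivity
  obtain ⟨J, hJ⟩ := term_bound H t ht0 ht1 hT δ1 hδ10
  obtain ⟨C, hC0, hC⟩ := logsq_le t (δ / 2 / (J + 1)) ht0 (by positivity)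
  refine ⟨(J + 1) * C, by positivity, fun d hd => ?_⟩
  have hd1 : (1 : ℝ) ≤ d := by exact_mod_cast hd
  have hd0 : (0 : ℝ) < d := by linarith
  have hld := Real.log_nonneg hd1
  have hterm : ∀ j ∈ Finset.range d, (1 + Real.log d) * g (j + 1) ≤
      (if j < J then (1 + Real.log d) else 0) +
        δ1 * K * (d : ℝ) ^ (t / 2) * ((j + 1 : ℕ) : ℝ) ^ (t / 2 - 1) := by
    intro j hj
    have hjd : ((j + 1 : ℕ) : ℝ) ≤ d := by
      exact_mod_cast Finset.mem_range.mp hj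
    have hj0 : (0 : ℝ) < ((j + 1 : ℕ) : ℝ) := by positivity
    have hj1 : (1 : ℝ) ≤ ((j + 1 : ℕ) : ℝ) := by
      exact_mod_cast Nat.succ_le_succ (Nat.zero_le j)
    have hg := H.pos (j + 1) (by omega)
    have hg1 := H.le_one (j + 1) (by omega)
    split_ifs with hjJ
    · have : 0 ≤ δ1 * K * (d : ℝ) ^ (t / 2) * ((j + 1 : ℕ) : ℝ) ^ (t / 2 - 1) := by positivity
      nlinarith
    · have h1 := hJ (j + 1) (by omega) (by omega)
      set i : ℝ := ((j + 1 : ℕ) : ℝ) with hi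
      have hy : 1 ≤ (d : ℝ) / i := by rw [le_div_iff₀ hj0]; linarith
      have h2 := one_add_log_le (t / 2) (d / i) (by positivity) hy
      have hli := Real.log_nonneg hj1
      have hly := Real.log_nonneg hy
      have h3 : Real.log d = Real.log i + Real.log (d / i) := by
        rw [Real.log_div hd0.ne' hj0.ne']; ring
      have h4 : 1 + Real.log d ≤ (1 + Real.log i) * (K * ((d : ℝ) / i) ^ (t / 2)) := by
        calc 1 + Real.log d ≤ (1 + Real.log i) * (1 + Real.log (d / i)) := by
              rw [h3]; nlinarith
          _ ≤ _ := by gcongr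
      have h5 : i ^ (t - 1) * ((d : ℝ) / i) ^ (t / 2) = (d : ℝ) ^ (t / 2) * i ^ (t / 2 - 1) := by
        rw [Real.div_rpow hd0.le hj0.le, div_eq_mul_inv, ← Real.rpow_neg hj0.le, mul_left_comm,
          ← Real.rpow_add hj0]
        congr 2; ring
      rw [zero_add]
      calc (1 + Real.log d) * g (j + 1) ≤ ((1 + Real.log i) * (K * ((d : ℝ) / i) ^ (t / 2))) * g (j + 1) := by
            gcongr
        _ = (g (j + 1) * (1 + Real.log i)) * (K * ((d : ℝ) / i) ^ (t / 2)) := by ring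
        _ ≤ (δ1 * i ^ (t - 1)) * (K * ((d : ℝ) / i) ^ (t / 2)) := by gcongr
        _ = δ1 * K * (i ^ (t - 1) * ((d : ℝ) / i) ^ (t / 2)) := by ring
        _ = _ := by rw [h5]; ring
  rw [Finset.mul_sum]
  refine (Finset.sum_le_sum hterm).trans ?_
  rw [Finset.sum_add_distrib, ← Finset.mul_sum]
  have hA : ∑ j ∈ Finset.range d, (if j < J then (1 + Real.log d) else 0) ≤
      δ / 2 * (d : ℝ) ^ t + (J + 1) * C := by
    have h1 : ∑ j ∈ Finset.range d, (if j < J then (1 + Real.log d) else 0) ≤ J * (1 + Real.log d) := by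
      rw [← Finset.sum_filter, Finset.sum_const, nsmul_eq_mul]
      refine mul_le_mul_of_nonneg_right ?_ (by linarith)
      have : (Finset.filter (fun j => j < J) (Finset.range d)) ⊆ Finset.range J := by
        intro j hj
        exact Finset.mem_range.mpr (Finset.mem_filter.mp hj).2
      have := Finset.card_le_card this
      rw [Finset.card_range] at this
      exact_mod_cast this
    have h2 := hC d hd1
    have h3 : (J : ℝ) * (1 + Real.log d) ≤ (J + 1) * (1 + Real.log d) ^ 2 := by
      have : (0 : ℝ) ≤ J := by positivity
      nlinarith [mul_nonneg this hld, mul_nonneg this (mul_nonneg hld hld)]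
    have h4 : ((J : ℝ) + 1) * (1 + Real.log d) ^ 2 ≤ (J + 1) * (δ / 2 / (J + 1) * (d : ℝ) ^ t + C) := by
      gcongr
    have h5 : ((J : ℝ) + 1) * (δ / 2 / (J + 1) * (d : ℝ) ^ t + C) = δ / 2 * (d : ℝ) ^ t + (J + 1) * C := by
      field_simp
    linarith
  have hB : δ1 * K * (d : ℝ) ^ (t / 2) * ∑ j ∈ Finset.range d, ((j + 1 : ℕ) : ℝ) ^ (t / 2 - 1) ≤
      δ / 2 * (d : ℝ) ^ t := by
    have h1 := sum_rpow_le (t / 2) (by positivity) (by linarith) d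
    have h2 : (d : ℝ) ^ t = (d : ℝ) ^ (t / 2) * (d : ℝ) ^ (t / 2) := by
      rw [← Real.rpow_add hd0]; congr 1; ring
    calc _ ≤ δ1 * K * (d : ℝ) ^ (t / 2) * ((d : ℝ) ^ (t / 2) / (t / 2)) := by gcongr
      _ = δ1 * (K / (t / 2)) * ((d : ℝ) ^ (t / 2) * (d : ℝ) ^ (t / 2)) := by ring
      _ = _ := by rw [← h2, hδ1]; field_simp
  linarith

lemma suff {g r : ℕ → ℝ} (H : KorHyp g r) (crit : Crit) (useStd : Bool)
    (s t : ℝ) (hs : 0 < s) (ht0 : 0 < t) (ht1 : t < 1)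
    (hT : Tendsto (fun j : ℕ => (j : ℝ) ^ (1 - t) * g j * lnplus (1 / g j)) atTop (nhds 0)) :
    ALGWTst s t (korNC g r useStd crit) := by
  intro δ hδ
  obtain ⟨A, hA, hbd⟩ := std_bound H
  set δ1 := δ / (4 * A) with hδ1
  have hδ10 : 0 < δ1 := by positivity
  obtain ⟨C1, hC1, h1⟩ := sum_bound H t ht0 ht1 hT δ1 hδ10
  obtain ⟨C2, hC2, h2⟩ := logsq_le t δ1 ht0 hδ10
  obtain ⟨C3, hC3, h3⟩ := logsq_le s δ1 hs hδ10
  set B := 2 * (A * (C1 + C2 + C3)) / δ + 1 with hB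
  have hB0 : 0 < B := by positivity
  refine ⟨2 * (B ^ (1 / s) + B ^ (1 / t)), fun d hd ε hε hM => ?_⟩
  have hε0 := hε.1
  have hd1 : (1 : ℝ) ≤ d := by exact_mod_cast hd
  have hy1 : 1 ≤ ε⁻¹ := by rw [one_le_inv₀ hε0]; exact hε.2.le
  have hy0 : 0 < ε⁻¹ := by linarith
  set y := ε⁻¹ with hy
  have hys : ε ^ (-s) = y ^ s := by rw [hy, Real.inv_rpow hε0.le, Real.rpow_neg hε0.le]
  simp only [hys]
  have hden : B ≤ y ^ s + (d : ℝ) ^ t := by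
    have p1 : 0 < B ^ (1 / s) := by positivity
    have p2 : 0 < B ^ (1 / t) := by positivity
    have q1 : 0 < y ^ s := by positivity
    have q2 : 0 < (d : ℝ) ^ t := by positivity
    by_cases hc : B ^ (1 / s) ≤ y
    · have := Real.rpow_le_rpow p1.le hc hs.le
      rw [← Real.rpow_mul hB0.le, one_div_mul_cancel hs.ne', Real.rpow_one] at this
      linarith
    · have hc' : B ^ (1 / t) ≤ d := by linarith
      have := Real.rpow_le_rpow p2.le hc' ht0.le
      rw [← Real.rpow_mul hB0.le, one_div_mul_cancel ht0.ne', Real.rpow_one] at this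
      linarith
  have hdp : 0 < y ^ s + (d : ℝ) ^ t := by linarith
  obtain ⟨n, hn, hn1, hlog⟩ := hbd d hd ε hε
  have hle := (korNC_le H useStd crit d n ε hn).1
  have hnn : 0 ≤ Real.log (korNC g r useStd crit d ε) := Real.log_natCast_nonneg _
  have hl : Real.log (korNC g r useStd crit d ε) ≤ Real.log n := by
    rcases Nat.eq_zero_or_pos (korNC g r useStd crit d ε) with h0 | h0
    · rw [h0]; simp; exact Real.log_natCast_nonneg _
    · exact Real.log_le_log (by exact_mod_cast h0) (by exact_mod_cast hle)
  rw [abs_of_nonneg (by positivity), div_lt_iff₀ hdp]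
  refine lt_of_le_of_lt (hl.trans hlog) ?_
  have k1 := h1 d hd
  have k2 := h2 d hd1
  have k3 := h3 y hy1
  set G := ∑ j ∈ Finset.range d, g (j + 1)
  have k4 : (1 + Real.log d) * (1 + G + Real.log y) ≤
      (1 + Real.log d) * G + (1 + Real.log d) ^ 2 + (1 + Real.log y) ^ 2 := by
    nlinarith [sq_nonneg ((1 + Real.log d) - (1 + Real.log y)), sq_nonneg (1 + Real.log d),
      sq_nonneg (1 + Real.log y)]
  have q1 : 0 < y ^ s := by positivity
  have k5 : (1 + Real.log d) * (1 + G + Real.log y) ≤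
      2 * δ1 * (y ^ s + (d : ℝ) ^ t) + (C1 + C2 + C3) := by nlinarith
  have k6 : A * ((1 + Real.log d) * (1 + G + Real.log y)) ≤
      A * (2 * δ1 * (y ^ s + (d : ℝ) ^ t) + (C1 + C2 + C3)) := mul_le_mul_of_nonneg_left k5 hA.le
  have k7 : A * (2 * δ1 * (y ^ s + (d : ℝ) ^ t) + (C1 + C2 + C3)) =
      δ / 2 * (y ^ s + (d : ℝ) ^ t) + A * (C1 + C2 + C3) := by
    rw [hδ1]; field_simp; ring
  have k8 : A * (C1 + C2 + C3) < δ / 2 * B := by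
    have : δ / 2 * B = A * (C1 + C2 + C3) + δ / 2 := by rw [hB]; field_simp
    linarith
  have k9 : δ / 2 * B ≤ δ / 2 * (y ^ s + (d : ℝ) ^ t) := by gcongr
  linarith


lemma phi_bound (gd g x y : ℝ) (hgd : 0 < gd) (hg : gd ≤ g) (hg1 : g ≤ 1) (hx : 2 * g ≤ x)
    (hy0 : 0 ≤ y) (hy : y ≤ g ^ (1 / lnplus (1 / gd)) * x) :
    gd / 6 ≤ Real.log (1 + x) - 1 / (1 + 1 / lnplus (1 / gd)) * Real.log (1 + y) := by
  have hL1 : 1 ≤ lnplus (1 / gd) := le_max_left _ _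
  set L := lnplus (1 / gd) with hL
  set η := 1 / L with hη
  have hL0 : 0 < L := by linarith
  have hη0 : 0 < η := by positivity
  have hη1 : η ≤ 1 := by rw [hη, div_le_one hL0]; exact hL1
  have hg0 : 0 < g := by linarith
  have hx0 : 0 < x := by linarith
  have hyl : 0 ≤ Real.log (1 + y) := Real.log_nonneg (by linarith)
  have hyx : y ≤ x := hy.trans (mul_le_of_le_one_left hx0.le (Real.rpow_le_one hg0.le hg1 hη0.le))
  have hlyx : Real.log (1 + y) ≤ Real.log (1 + x) := Real.log_le_log (by linarith) (by linarith)
  have hp1 : 1 / (1 + η) ≤ 1 - η / 2 := by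
    rw [div_le_iff₀ (by linarith)]; nlinarith
  have hp2 : 1 / (1 + η) ≤ 1 := by linarith
  have hlx : 2 * g / 3 ≤ Real.log (1 + x) := by
    have h1 := Real.one_sub_inv_le_log_of_pos (x := 1 + x) (by linarith)
    have h2 : 2 * g / 3 ≤ 1 - (1 + x)⁻¹ := by
      have : (1 + x)⁻¹ ≤ 1 - 2 * g / 3 := by
        rw [inv_le_iff_one_le_mul₀ (by linarith)]; nlinarith
      linarith
    linarith
  have hgen : η * g / 3 ≤ Real.log (1 + x) - 1 / (1 + η) * Real.log (1 + y) := by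
    have h1 : 1 / (1 + η) * Real.log (1 + y) ≤ (1 - η / 2) * Real.log (1 + x) :=
      mul_le_mul hp1 hlyx hyl (by linarith)
    nlinarith
  by_cases hc : Real.log (1 / gd) ≤ 1
  · have : L = 1 := by rw [hL, lnplus, max_eq_left hc]
    rw [this] at hη
    rw [hη] at hgen ⊢
    linarith
  have hLe : L = Real.log (1 / gd) := by rw [hL, lnplus, max_eq_right (by linarith)]
  have hsq0 : 0 < √gd := Real.sqrt_pos.mpr hgd
  have hsq : √gd * √gd = gd := Real.mul_self_sqrt hgd.le
  have hLe2 : L = - Real.log gd := by rw [hLe, one_div, Real.log_inv]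
  have hlg : Real.log (√gd) = Real.log gd / 2 := Real.log_sqrt hgd.le
  by_cases hc2 : √gd ≤ g
  · have h1 : L ≤ 2 / √gd := by
      have := Real.one_sub_inv_le_log_of_pos hsq0
      rw [hlg] at this
      rw [hLe2, div_eq_mul_inv]; linarith
    have h2 : √gd / 2 ≤ η := by
      rw [hη, le_div_iff₀ hL0]
      rw [le_div_iff₀ hsq0] at h1; linarith
    have : √gd / 2 * √gd ≤ η * g := mul_le_mul h2 hc2 hsq0.le hη0.le
    linarith
  · push Not at hc2
    have h1 : g ^ η ≤ 2 / 3 := by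
      have hl : Real.log g ≤ - L / 2 := by
        have := Real.log_le_log hg0 hc2.le
        rw [hlg] at this; linarith
      rw [Real.rpow_def_of_pos hg0]
      have h2 : Real.log g * η ≤ -(1 / 2) := by
        rw [hη, mul_one_div, div_le_iff₀ hL0]; linarith
      have h3 : (3 / 2 : ℝ) ≤ Real.exp (1 / 2) := by
        have := Real.add_one_le_exp (1 / 2 : ℝ); linarith
      calc _ ≤ Real.exp (-(1 / 2)) := Real.exp_le_exp.mpr h2
        _ = (Real.exp (1 / 2))⁻¹ := Real.exp_neg _
        _ ≤ (3 / 2)⁻¹ := inv_anti₀ (by norm_num) h3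
        _ = 2 / 3 := by norm_num
    have h2 : y ≤ 2 / 3 * x := hy.trans (mul_le_mul_of_nonneg_right h1 hx0.le)
    have h3 : 1 / (1 + η) * Real.log (1 + y) ≤ Real.log (1 + 2 / 3 * x) :=
      (mul_le_of_le_one_left hyl hp2).trans (Real.log_le_log (by linarith) (by linarith))
    have h4 := Real.one_sub_inv_le_log_of_pos (x := (1 + x) / (1 + 2 / 3 * x)) (by positivity)
    rw [Real.log_div (by positivity) (by positivity), inv_div] at h4
    have h5 : (1 + 2 / 3 * x) / (1 + x) ≤ 1 - 2 * g / 9 := by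
      rw [div_le_iff₀ (by linarith)]; nlinarith
    linarith

lemma box_bounds {g r : ℕ → ℝ} (H : KorHyp g r) (j : ℕ) (B : ℤ) (hB : 1 ≤ B) (η : ℝ) (hη : 0 ≤ η) :
    ∃ x y : ℝ, 2 * g (j + 1) ≤ x ∧ 0 ≤ y ∧ y ≤ g (j + 1) ^ η * x ∧
      ∑ h ∈ Finset.Icc (-B) B, mu g r j h = 1 + x ∧
      ∑ h ∈ Finset.Icc (-B) B, mu g r j h ^ (1 + η) = 1 + y := by
  have h0 : (0 : ℤ) ∈ Finset.Icc (-B) B := by rw [Finset.mem_Icc]; omega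
  refine ⟨∑ h ∈ (Finset.Icc (-B) B).erase 0, mu g r j h,
    ∑ h ∈ (Finset.Icc (-B) B).erase 0, mu g r j h ^ (1 + η), ?_, ?_, ?_, ?_, ?_⟩
  · have hsub : ({1, -1} : Finset ℤ) ⊆ (Finset.Icc (-B) B).erase 0 := by
      intro h hh
      rw [Finset.mem_insert, Finset.mem_singleton] at hh
      rw [Finset.mem_erase, Finset.mem_Icc]
      omega
    refine le_trans (le_of_eq ?_)
      (Finset.sum_le_sum_of_subset_of_nonneg hsub (fun h _ _ => (mu_pos H j h).le))
    rw [Finset.sum_pair (by norm_num)]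
    simp [mu]; ring
  · exact Finset.sum_nonneg (fun h _ => Real.rpow_nonneg (mu_pos H j h).le _)
  · rw [Finset.mul_sum]
    refine Finset.sum_le_sum (fun h hh => ?_)
    have hne := (Finset.mem_erase.mp hh).1
    rw [add_comm, Real.rpow_add_one (mu_pos H j h).ne']
    refine mul_le_mul_of_nonneg_right ?_ (mu_pos H j h).le
    refine Real.rpow_le_rpow (mu_pos H j h).le ?_ hη
    rw [mu, if_neg hne]
    refine mul_le_of_le_one_right (H.pos _ (by omega)).le ?_
    refine Real.rpow_le_one_of_one_le_of_nonpos (one_le_abs hne) ?_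
    have := H.rmono (j + 1) (by omega)
    have := H.r1
    linarith
  · rw [← Finset.add_sum_erase _ _ h0]; simp [mu]
  · rw [← Finset.add_sum_erase _ _ h0]; simp [mu]

lemma big_box {g r : ℕ → ℝ} (H : KorHyp g r) (d : ℕ) : ∃ B : ℤ, 1 ≤ B ∧
    (∑' k, ((korWeight g r d k) ^ 2)⁻¹) / 2 ≤
      ∑ k ∈ Fintype.piFinset (fun _ : Fin d => Finset.Icc (-B) B), ((korWeight g r d k) ^ 2)⁻¹ ∧
    1 ≤ ∑' k, ((korWeight g r d k) ^ 2)⁻¹ := by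
  classical
  have hs := lam_summable H d
  set N := ∑' k, ((korWeight g r d k) ^ 2)⁻¹ with hN
  have hN1 : 1 ≤ N := by
    have := hs.le_tsum 0 (fun k _ => by positivity)
    rw [korWeight_zero] at this
    simpa using this
  have hlt : N / 2 < N := by linarith
  obtain ⟨F, hF⟩ := (hs.hasSum.eventually (lt_mem_nhds hlt)).exists
  refine ⟨1 + ∑ k ∈ F, ∑ j, |k j|, ?_, ?_, hN1⟩
  · have : 0 ≤ ∑ k ∈ F, ∑ j, |k j| :=
      Finset.sum_nonneg (fun k _ => Finset.sum_nonneg (fun j _ => abs_nonneg _))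
    linarith
  · refine hF.le.trans (Finset.sum_le_sum_of_subset_of_nonneg ?_ (fun k _ _ => by positivity))
    intro k hk
    rw [Fintype.mem_piFinset]
    intro j
    have h1 : |k j| ≤ ∑ j, |k j| :=
      Finset.single_le_sum (f := fun j => |k j|) (fun i _ => abs_nonneg _) (Finset.mem_univ j)
    have h2 : ∑ j, |k j| ≤ ∑ k ∈ F, ∑ j, |k j| :=
      Finset.single_le_sum (f := fun k : Fin d → ℤ => ∑ j, |k j|)
        (fun i _ => Finset.sum_nonneg (fun j _ => abs_nonneg _)) hk
    rw [Finset.mem_Icc, ← abs_le]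
    linarith

lemma nec_bound {g r : ℕ → ℝ} (H : KorHyp g r) (crit : Crit) (useStd : Bool) (d : ℕ) (hd : 0 < d) :
    lnplus (1 / g d) * (d * g d / 6 - 1) ≤ Real.log (korNC g r useStd crit d (1 / 2)) := by
  obtain ⟨A, hA, hbd⟩ := std_bound H
  obtain ⟨n0, hn0, -, -⟩ := hbd d hd (1 / 2) ⟨by norm_num, by norm_num⟩
  have hw := (korNC_le H useStd crit d n0 (1 / 2) hn0).2
  set n := korNC g r useStd crit d (1 / 2) with hn
  obtain ⟨B, hB1, hB, hN1⟩ := big_box H d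
  set N := ∑' k, ((korWeight g r d k) ^ 2)⁻¹ with hN
  have hcri : CRI (korWeight g r d) crit ≤ ENNReal.ofReal (√N) := by
    cases crit
    · change (1 : ℝ≥0∞) ≤ _
      rw [ENNReal.one_le_ofReal]
      exact Real.one_le_sqrt.mpr hN1
    · exact initErr_le _ (lam_summable H d)
  have hL1 : 1 ≤ lnplus (1 / g d) := le_max_left _ _
  set L := lnplus (1 / g d) with hL
  have hL0 : 0 < L := by linarith
  set η := 1 / L with hη
  have hη0 : 0 < η := by positivity
  have hw2 : wcErr (korWeight g r d) (allInfo d) n ≤ ENNReal.ofReal (√N / 2) := by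
    refine hw.trans ?_
    calc _ ≤ ENNReal.ofReal (1 / 2) * ENNReal.ofReal (√N) := by gcongr
      _ = ENNReal.ofReal (√N / 2) := by
        rw [← ENNReal.ofReal_mul (by norm_num)]; congr 1; ring
  set K := Fintype.piFinset (fun _ : Fin d => Finset.Icc (-B) B) with hK
  have hlow := (all_lower (korWeight g r d) K n (1 + η) (by linarith)).trans hw2
  rw [ENNReal.ofReal_le_ofReal_iff (by positivity)] at hlow
  have hsum1 : ∑ k ∈ K, ((korWeight g r d k) ^ 2)⁻¹ = ∏ j : Fin d, ∑ h ∈ Finset.Icc (-B) B, mu g r j h := by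
    have := sum_box H d 1 (fun _ : Fin d => Finset.Icc (-B) B)
    simpa only [Real.rpow_one] using this
  have hsum2 := sum_box H d (1 + η) (fun _ : Fin d => Finset.Icc (-B) B)
  rw [← hK] at hsum2
  rw [hsum2] at hlow
  choose x y hx hy0 hy hxs hys using fun j : ℕ => box_bounds H j B hB1 η hη0.le
  have hgp : ∀ j : ℕ, 0 < g (j + 1) := fun j => H.pos _ (by omega)
  have hx0 : ∀ j, 0 < x j := fun j => by linarith [hx j, hgp j]
  simp only [hxs] at hsum1
  simp only [hys] at hlow
  rw [hsum1] at hlow hB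
  set X := ∏ j : Fin d, (1 + x j) with hX
  set Y := ∏ j : Fin d, (1 + y j) with hY
  have hX0 : 0 < X := Finset.prod_pos (fun j _ => by linarith [hx0 j])
  have hY0 : 0 < Y := Finset.prod_pos (fun j _ => by linarith [hy0 j])
  have hsq : X - Y ^ (1 / (1 + η)) * (n : ℝ) ^ (1 - 1 / (1 + η)) ≤ N / 4 := by
    have h := Real.sqrt_le_left (by positivity) |>.mp hlow
    rw [div_pow, Real.sq_sqrt (by linarith)] at h
    linarith
  have hkey : X / 2 ≤ Y ^ (1 / (1 + η)) * (n : ℝ) ^ (1 - 1 / (1 + η)) := by linarith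
  have hp : 1 - 1 / (1 + η) = η / (1 + η) := by field_simp; ring
  have hp0 : 0 < 1 - 1 / (1 + η) := by rw [hp]; positivity
  have hn0 : 0 < n := by
    rcases Nat.eq_zero_or_pos n with h | h
    · rw [h, Nat.cast_zero, Real.zero_rpow hp0.ne', mul_zero] at hkey
      linarith
    · exact h
  have hnR : (0 : ℝ) < n := by exact_mod_cast hn0
  have hlog := Real.log_le_log (by positivity) hkey
  rw [Real.log_div hX0.ne' (by norm_num), Real.log_mul (by positivity) (by positivity),
    Real.log_rpow hY0, Real.log_rpow hnR, hX, hY,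
    Real.log_prod (fun j _ => by linarith [hx0 j]),
    Real.log_prod (fun j _ => by linarith [hy0 j])] at hlog
  have hphi : (d : ℝ) * (g d / 6) ≤ ∑ j : Fin d, Real.log (1 + x j) -
      1 / (1 + η) * ∑ j : Fin d, Real.log (1 + y j) := by
    rw [Finset.mul_sum, ← Finset.sum_sub_distrib]
    have : ∑ _j : Fin d, g d / 6 = (d : ℝ) * (g d / 6) := by simp
    rw [← this]
    refine Finset.sum_le_sum (fun j _ => ?_)
    exact phi_bound (g d) (g (j + 1)) (x j) (y j) (H.pos d hd)
      (H.anti _ _ (by omega) (by have := j.2; omega)) (H.le_one _ (by omega)) (hx j) (hy0 j) (hy j)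
  have hl2 := Real.log_two_lt_d9
  have hlogn : 0 ≤ Real.log n := Real.log_natCast_nonneg _
  have hpη : 1 - 1 / (1 + η) ≤ η := by
    rw [hp]; exact div_le_self hη0.le (by linarith)
  have h1 : (d : ℝ) * g d / 6 - 1 ≤ η * Real.log n := by
    have := mul_le_mul_of_nonneg_right hpη hlogn
    linarith
  calc _ ≤ L * (η * Real.log n) := mul_le_mul_of_nonneg_left h1 hL0.le
    _ = Real.log n := by rw [hη]; field_simp

lemma lnplus_le (y : ℝ) (hy : 1 ≤ y) : lnplus y ≤ 1 + Real.log y := by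
  have := Real.log_nonneg hy
  exact max_le (by linarith) (by linarith)

lemma nec {g r : ℕ → ℝ} (H : KorHyp g r) (crit : Crit) (useStd : Bool)
    (s t : ℝ) (ht0 : 0 < t) (ht1 : t < 1)
    (hW : ALGWTst s t (korNC g r useStd crit)) :
    Tendsto (fun j : ℕ => (j : ℝ) ^ (1 - t) * g j * lnplus (1 / g j)) atTop (nhds 0) := by
  set K := 1 + 1 / (t / 2) with hK
  have hK0 : 0 < K := by positivity
  set S := (1 / 2 : ℝ) ^ (-s) with hS
  have hS0 : 0 < S := by positivity
  have hdt : Tendsto (fun d : ℕ => (d : ℝ) ^ (-(t / 2))) atTop (nhds 0) :=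
    (tendsto_rpow_neg_atTop (by positivity)).comp tendsto_natCast_atTop_atTop
  rw [Metric.tendsto_atTop]
  intro e he
  obtain ⟨M, hM⟩ := hW (e / 24) (by positivity)
  have hc0 : 0 < e / (4 * (6 * S * (e / 24) + 7 * K)) := by positivity
  obtain ⟨D, hD⟩ := eventually_atTop.mp (hdt.eventually (gt_mem_nhds hc0))
  refine ⟨max (max 1 D) ⌈M⌉₊, fun d hd => ?_⟩
  have hd1 : 1 ≤ d := (le_max_left _ _).trans ((le_max_left _ _).trans hd)
  have hdD : D ≤ d := (le_max_right _ _).trans ((le_max_left _ _).trans hd)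
  have hdM : M ≤ d := (Nat.le_ceil M).trans (by exact_mod_cast (le_max_right _ _).trans hd)
  have hd1' : (1 : ℝ) ≤ d := by exact_mod_cast hd1
  have hd0 : (0 : ℝ) < d := by linarith
  have hz := hD d hdD
  rw [lt_div_iff₀ (by positivity)] at hz
  have hz0 : 0 < (d : ℝ) ^ (-(t / 2)) := by positivity
  set z := (d : ℝ) ^ (-(t / 2)) with hzdef
  have hz1 : z ≤ 1 := Real.rpow_le_one_of_one_le_of_nonpos hd1' (by linarith)
  have hg := H.pos d hd1
  have hg1 := H.le_one d hd1
  have hy1 : 1 ≤ 1 / g d := by rw [le_div_iff₀ hg]; linarith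
  have hL1 : 1 ≤ lnplus (1 / g d) := le_max_left _ _
  have hLl := lnplus_le _ hy1
  set L := lnplus (1 / g d) with hL
  have hval0 : 0 ≤ (d : ℝ) ^ (1 - t) * g d * L := by positivity
  rw [Real.dist_eq, sub_zero, abs_of_nonneg hval0]
  have hpos : 0 ≤ 6 * S * (e / 24) * z := by positivity
  have hpos2 : 0 ≤ K * z := by positivity
  by_cases hc : 1 / g d ≤ d
  · have hb := nec_bound H crit useStd d hd1
    rw [← hL] at hb
    have hw := hM d hd1 (1 / 2) ⟨by norm_num, by norm_num⟩ (by norm_num; linarith)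
    have hden : 0 < S + (d : ℝ) ^ t := by positivity
    have hw2 := (abs_lt.mp hw).2
    simp only [← hS] at hw2
    rw [div_lt_iff₀ hden] at hw2
    have hLd : L ≤ K * (d : ℝ) ^ (t / 2) := by
      have h1 := one_add_log_le (t / 2) d (by positivity) hd1'
      rw [← hK] at h1
      have h2 := Real.log_le_log (by positivity) hc
      linarith
    have hmain : d * g d * L ≤ 6 * (e / 24 * (S + (d : ℝ) ^ t)) + 6 * (K * (d : ℝ) ^ (t / 2)) := by
      nlinarith
    have e1 : (d : ℝ) ^ (1 - t) = d * (z * z) := by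
      rw [hzdef, ← Real.rpow_add hd0, mul_comm, ← Real.rpow_add_one hd0.ne']; congr 1; ring
    have e2 : (d : ℝ) ^ t * (z * z) = 1 := by
      rw [hzdef, ← Real.rpow_add hd0, ← Real.rpow_add hd0]
      rw [show t + (-(t / 2) + -(t / 2)) = 0 by ring, Real.rpow_zero]
    have e3 : (d : ℝ) ^ (t / 2) * z = 1 := by
      rw [hzdef, ← Real.rpow_add hd0, add_neg_cancel, Real.rpow_zero]
    have hzz : 0 < z * z := by positivity
    have h5 := mul_le_mul_of_nonneg_right hmain hzz.le
    have h6 : (6 * (e / 24 * (S + (d : ℝ) ^ t)) + 6 * (K * (d : ℝ) ^ (t / 2))) * (z * z) =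
        6 * S * (e / 24) * (z * z) + e / 4 + 6 * K * z := by
      have : (6 * (e / 24 * (S + (d : ℝ) ^ t)) + 6 * (K * (d : ℝ) ^ (t / 2))) * (z * z) =
        6 * S * (e / 24) * (z * z) + e / 4 * ((d : ℝ) ^ t * (z * z)) +
          6 * K * z * ((d : ℝ) ^ (t / 2) * z) := by ring
      rw [this, e2, e3]; ring
    have h7 : (d : ℝ) ^ (1 - t) * g d * L = d * g d * L * (z * z) := by rw [e1]; ring
    have h8 : 6 * S * (e / 24) * (z * z) ≤ 6 * S * (e / 24) * z := by
      rw [← mul_assoc]; exact mul_le_of_le_one_right hpos hz1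
    rw [h7]
    linarith
  · push Not at hc
    have h1 := one_add_log_le (t / 2) (1 / g d) (by positivity) hy1
    rw [← hK] at h1
    have h2 : L ≤ K * (1 / g d) ^ (t / 2) := by linarith
    have h3 : g d * (1 / g d) ^ (t / 2) = (1 / g d) ^ (t / 2 - 1) := by
      rw [Real.rpow_sub_one (by positivity)]; field_simp
    have h4 : (1 / g d) ^ (t / 2 - 1) ≤ (d : ℝ) ^ (t / 2 - 1) :=
      Real.rpow_le_rpow_of_nonpos hd0 hc.le (by linarith)
    have h5 : (d : ℝ) ^ (1 - t) * (d : ℝ) ^ (t / 2 - 1) = z := by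
      rw [← Real.rpow_add hd0, hzdef]; congr 1; ring
    have : (d : ℝ) ^ (1 - t) * g d * L ≤ K * z := by
      calc _ ≤ (d : ℝ) ^ (1 - t) * g d * (K * (1 / g d) ^ (t / 2)) := by gcongr
        _ = K * ((d : ℝ) ^ (1 - t) * (g d * (1 / g d) ^ (t / 2))) := by ring
        _ ≤ K * ((d : ℝ) ^ (1 - t) * (d : ℝ) ^ (t / 2 - 1)) := by rw [h3]; gcongr
        _ = K * z := by rw [h5]
    linarith

/-- For the weighted Korobov spaces, for either information class and
either error criterion, and `s > 0`, `0 < t < 1`: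
ALG-`(s,t)`-WT ⟺ `lim_j j^{1-t} g_j ln₊(1/g_j) = 0`. -/
theorem stmt15
    (g r : ℕ → ℝ)
    (hg1 : g 1 ≤ 1) (hgpos : ∀ j, 1 ≤ j → 0 < g j)
    (hgmono : ∀ j, 1 ≤ j → g (j + 1) ≤ g j)
    (hr1 : 1 / 2 < r 1) (hrmono : ∀ j, 1 ≤ j → r j ≤ r (j + 1))
    (crit : Crit) (useStd : Bool)
    (s t : ℝ) (hs : 0 < s) (ht0 : 0 < t) (ht1 : t < 1) :
    ALGWTst s t (korNC g r useStd crit) ↔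
      Filter.Tendsto (fun j : ℕ => (j : ℝ) ^ (1 - t) * g j * lnplus (1 / g j))
        Filter.atTop (nhds 0) := by
  have H := korHyp_of g r hg1 hgpos hgmono hr1 hrmono
  exact ⟨fun h => nec H crit useStd s t ht0 ht1 h, fun h => suff H crit useStd s t hs ht0 ht1 h⟩
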